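/- arXiv:1207.6249 — 2 statements merged into one kernel-verified Lean document; each statement's English description precedes it below -/
import Mathlib

section
/- Let G be a graph on [n], v a simplicial vertex of G, and G_1 = G \ v. If I = I(Ḡ) and J = I(Ḡ_1) are nonzero edge ideals in S = K[x_1,…,x_n], then reg(I) = reg(J). -/
open MvPolynomial

noncomputable section

/-- The irrelevant (graded maximal) ideal `(x_i : i)` of a polynomial ring. -/
def irrelevantIdeal (K : Type) [Field K] (σ : Type) : Ideal (MvPolynomial σ K) :=
  Ideal.span (Set.range (X : σ → MvPolynomial σ K))

/-- `depthIdeal m M` is the depth of the module `M` with respect to the ideal `m`: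
the supremum of lengths of `M`-regular sequences with entries in `m`. -/
def depthIdeal {R : Type} [CommRing R] (m : Ideal R)
    (M : Type) [AddCommGroup M] [Module R M] : ℕ :=
  sSup {k | ∃ rs : List R, rs.length = k ∧ (∀ r ∈ rs, r ∈ m) ∧
    RingTheory.Sequence.IsRegular M rs}

/-- `I` is a squarefree monomial ideal: generated by squarefree monomials. -/
def IsSqFreeMonomialIdeal {K : Type} [Field K] {σ : Type}
    (I : Ideal (MvPolynomial σ K)) : Prop :=
  ∃ 𝒮 : Set (Finset σ),
    I = Ideal.span ((fun s : Finset σ => ∏ i ∈ s, (X i : MvPolynomial σ K)) '' 𝒮)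

/-- `I` is a squarefree monomial ideal generated in degree `d`. -/
def IsSqFreeMonomialIdealInDegree {K : Type} [Field K] {σ : Type}
    (I : Ideal (MvPolynomial σ K)) (d : ℕ) : Prop :=
  ∃ 𝒮 : Set (Finset σ), (∀ s ∈ 𝒮, s.card = d) ∧
    I = Ideal.span ((fun s : Finset σ => ∏ i ∈ s, (X i : MvPolynomial σ K)) '' 𝒮)

/-- The Alexander dual of a squarefree monomial ideal: the intersection of the prime
ideals `P_M = (x_i : x_i ∣ M)` over the (squarefree) monomials `M` in `I`. -/
def alexDual {K : Type} [Field K] {σ : Type}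
    (I : Ideal (MvPolynomial σ K)) : Ideal (MvPolynomial σ K) :=
  ⨅ (s : Finset σ) (_ : (∏ i ∈ s, (X i : MvPolynomial σ K)) ∈ I),
    Ideal.span ((fun i : σ => (X i : MvPolynomial σ K)) '' ↑s)

/-- The edge ideal of a simple graph. -/
def edgeIdeal (K : Type) [Field K] {σ : Type} (G : SimpleGraph σ) :
    Ideal (MvPolynomial σ K) :=
  Ideal.span {p | ∃ i j : σ, G.Adj i j ∧ p = X i * X j}

/-- A minimal graded free resolution of a (homogeneous) ideal `I` in a polynomial ring:
an exact sequence `⋯ → F₁ → F₀ → I → 0` of free modules `Fᵢ = ⊕ S(-degᵢ b)`, with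
degree-zero (homogeneous) differentials whose matrix entries lie in the irrelevant
maximal ideal (minimality). -/
structure MinimalGradedFreeResolution {K : Type} [Field K] {σ : Type}
    (I : Ideal (MvPolynomial σ K)) where
  ι : ℕ → Type
  finite : ∀ i, Finite (ι i)
  deg : ∀ i, ι i → ℕ
  d : ∀ i, (ι (i + 1) →₀ MvPolynomial σ K) →ₗ[MvPolynomial σ K]
      (ι i →₀ MvPolynomial σ K)
  ε : (ι 0 →₀ MvPolynomial σ K) →ₗ[MvPolynomial σ K] MvPolynomial σ K
  range_ε : LinearMap.range ε = I
  exact_ε : LinearMap.ker ε = LinearMap.range (d 0)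
  exact_d : ∀ i, LinearMap.ker (d i) = LinearMap.range (d (i + 1))
  homog_ε : ∀ b : ι 0, (ε (Finsupp.single b 1)).IsHomogeneous (deg 0 b)
  homog_d : ∀ i, ∀ b : ι (i + 1), ∀ c : ι i,
      (d i (Finsupp.single b 1)) c = 0 ∨
      (deg i c ≤ deg (i + 1) b ∧
        ((d i (Finsupp.single b 1)) c).IsHomogeneous (deg (i + 1) b - deg i c))
  minimal : ∀ i, ∀ b : ι (i + 1), ∀ c : ι i,
      constantCoeff ((d i (Finsupp.single b 1)) c) = 0

namespace MinimalGradedFreeResolution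

variable {K : Type} [Field K] {σ : Type} {I : Ideal (MvPolynomial σ K)}

/-- The graded Betti number `β_{i,j}` read off from a minimal graded free resolution. -/
def betti (R : MinimalGradedFreeResolution I) (i j : ℕ) : ℕ :=
  Nat.card {b : R.ι i // R.deg i b = j}

end MinimalGradedFreeResolution

/-- The graded Betti number `β_{i,j}(I)` (well defined since all minimal graded free
resolutions of `I` have the same Betti numbers). -/
def bettiNumber {K : Type} [Field K] {σ : Type} (I : Ideal (MvPolynomial σ K))
    (i j : ℕ) : ℕ :=
  sSup {b | ∃ R : MinimalGradedFreeResolution I, R.betti i j = b}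

/-- Castelnuovo–Mumford regularity: `reg I = sup { j - i : β_{i,j}(I) ≠ 0 }`. -/
def reg {K : Type} [Field K] {σ : Type} (I : Ideal (MvPolynomial σ K)) : ℕ :=
  sSup {r | ∃ i j : ℕ, bettiNumber I i j ≠ 0 ∧ j = i + r}

/-- The initial degree of a homogeneous ideal: the least degree of a nonzero
homogeneous element. -/
def indeg {K : Type} [Field K] {σ : Type} (I : Ideal (MvPolynomial σ K)) : ℕ :=
  sInf {d | ∃ p ∈ I, p ≠ 0 ∧ MvPolynomial.IsHomogeneous p d}

/-- `I` has a `d`-linear resolution: it admits a minimal graded free resolution all of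
whose Betti numbers are concentrated in `β_{i,i+d}`. -/
def HasLinearResolution {K : Type} [Field K] {σ : Type}
    (I : Ideal (MvPolynomial σ K)) (dd : ℕ) : Prop :=
  ∃ R : MinimalGradedFreeResolution I, ∀ i j : ℕ, R.betti i j ≠ 0 → j = i + dd

end

noncomputable section

/-- All monomials of `p` have degree `e - a`. -/
def Hm {K σ : Type} [Field K] (p : MvPolynomial σ K) (a e : ℕ) : Prop :=
  ∀ m, coeff m p ≠ 0 → m.degree + a = e

/-- Graded linear maps between free modules. -/
def GrL {K σ A B : Type} [Field K] (da : A → ℕ) (db : B → ℕ)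
    (L : (A →₀ MvPolynomial σ K) →ₗ[MvPolynomial σ K] (B →₀ MvPolynomial σ K)) : Prop :=
  ∀ a b, Hm (L (Finsupp.single a 1) b) (db b) (da a)

section basics
variable {K σ : Type} [Field K]

theorem Hm.zero (a e : ℕ) : Hm (0 : MvPolynomial σ K) a e := by
  intro m h; simp at h

theorem Hm.add {p q : MvPolynomial σ K} {a e : ℕ} (hp : Hm p a e) (hq : Hm q a e) :
    Hm (p + q) a e := by
  intro m h
  by_cases h1 : coeff m p = 0
  · apply hq m; intro h2; apply h; simp [h1, h2]
  · exact hp m h1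

theorem Hm.neg {p : MvPolynomial σ K} {a e : ℕ} (hp : Hm p a e) : Hm (-p) a e := by
  intro m h; apply hp m; simpa using h

theorem Hm.sum {α : Type} (s : Finset α) (f : α → MvPolynomial σ K) {a e : ℕ}
    (h : ∀ i ∈ s, Hm (f i) a e) : Hm (∑ i ∈ s, f i) a e := by
  classical
  induction s using Finset.induction_on with
  | empty => simpa using Hm.zero a e
  | insert i s hi ih =>
    rw [Finset.sum_insert hi]
    exact (h i (by simp)).add (ih fun j hj => h j (by simp [hj]))

theorem Hm.mul {p q : MvPolynomial σ K} {a e f : ℕ} (hp : Hm p e f) (hq : Hm q a e) :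
    Hm (p * q) a f := by
  classical
  intro m h
  rw [coeff_mul] at h
  obtain ⟨⟨u, w⟩, huw, hne⟩ := Finset.exists_ne_zero_of_sum_ne_zero h
  have h1 := hp u (left_ne_zero_of_mul hne)
  have h2 := hq w (right_ne_zero_of_mul hne)
  have h3 : u + w = m := by simpa using huw
  rw [← h3, map_add]; omega

theorem wt_one (m : σ →₀ ℕ) : Finsupp.weight (1 : σ → ℕ) m = m.degree := by
  have := Finsupp.degree_eq_weight_one (σ := σ) (R := ℕ)
  rw [this]; rfl

theorem Hm_iff (p : MvPolynomial σ K) (a e : ℕ) :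
    (p = 0 ∨ (a ≤ e ∧ p.IsHomogeneous (e - a))) ↔ Hm p a e := by
  constructor
  · rintro (rfl | ⟨h1, h2⟩)
    · exact Hm.zero _ _
    · intro m hm
      have := h2 hm
      rw [wt_one] at this
      omega
  · intro h
    by_cases hp : p = 0
    · exact Or.inl hp
    · right
      obtain ⟨m, hm⟩ := exists_coeff_ne_zero hp
      have h1 := h m hm
      refine ⟨by omega, ?_⟩
      intro m' hm'
      rw [wt_one]
      have := h m' hm'
      omega

theorem Hm_zero_iff (p : MvPolynomial σ K) (e : ℕ) : p.IsHomogeneous e ↔ Hm p 0 e := by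
  constructor
  · intro h m hm
    have := h hm
    rw [wt_one] at this
    omega
  · intro h m hm
    rw [wt_one]
    have := h m hm
    omega

theorem Hm.cc {p : MvPolynomial σ K} {a e : ℕ} (h : Hm p a e) (hne : a ≠ e) :
    constantCoeff p = 0 := by
  by_contra hc
  have := h 0 hc
  simp at this; exact hne this

theorem Hm.one (a : ℕ) : Hm (1 : MvPolynomial σ K) a a := by
  classical
  intro m h
  rw [coeff_one] at h
  have : 0 = m := by by_contra h1; simp [h1] at h
  simp [← this]

theorem Hm.X (i : σ) (a : ℕ) : Hm (X i : MvPolynomial σ K) a (a + 1) := by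
  classical
  intro m h
  rw [coeff_X] at h
  have : Finsupp.single i 1 = m := by by_contra h1; simp [h1] at h
  simp [← this, add_comm]

theorem map_apply_eq {A B : Type} [Fintype A]
    (L : (A →₀ MvPolynomial σ K) →ₗ[MvPolynomial σ K] (B →₀ MvPolynomial σ K))
    (x : A →₀ MvPolynomial σ K) (b : B) :
    L x b = ∑ a, x a * L (Finsupp.single a 1) b := by
  classical
  have hx : x = ∑ a, x a • Finsupp.single a (1 : MvPolynomial σ K) := by
    ext a : 1
    simp
  conv_lhs => rw [hx]
  simp only [map_sum, map_smul, Finsupp.finsetSum_apply, Finsupp.smul_apply, smul_eq_mul]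

theorem map_apply_eq' {A : Type} [Fintype A]
    (L : (A →₀ MvPolynomial σ K) →ₗ[MvPolynomial σ K] MvPolynomial σ K)
    (x : A →₀ MvPolynomial σ K) :
    L x = ∑ a, x a * L (Finsupp.single a 1) := by
  classical
  have hx : x = ∑ a, x a • Finsupp.single a (1 : MvPolynomial σ K) := by
    ext a : 1
    simp
  conv_lhs => rw [hx]
  simp only [map_sum, map_smul, smul_eq_mul]

theorem GrL.map {A B : Type} [Finite A] {da : A → ℕ} {db : B → ℕ}
    {L : (A →₀ MvPolynomial σ K) →ₗ[MvPolynomial σ K] (B →₀ MvPolynomial σ K)}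
    (hL : GrL da db L) {x : A →₀ MvPolynomial σ K} {e : ℕ} (hx : ∀ a, Hm (x a) (da a) e) (b : B) :
    Hm (L x b) (db b) e := by
  have := Fintype.ofFinite A
  rw [map_apply_eq]
  exact Hm.sum _ _ fun a _ => (hx a).mul (hL a b)

theorem GrL.comp {A B C : Type} [Finite B] {da : A → ℕ} {db : B → ℕ} {dc : C → ℕ}
    {L : (A →₀ MvPolynomial σ K) →ₗ[MvPolynomial σ K] (B →₀ MvPolynomial σ K)}
    {L' : (B →₀ MvPolynomial σ K) →ₗ[MvPolynomial σ K] (C →₀ MvPolynomial σ K)}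
    (hL' : GrL db dc L') (hL : GrL da db L) : GrL da dc (L' ∘ₗ L) := by
  intro a c
  exact hL'.map (fun b => hL a b) c

theorem Hm_single {A : Type} (da : A → ℕ) (a b : A) :
    Hm (Finsupp.single a (1 : MvPolynomial σ K) b) (da b) (da a) := by
  classical
  rw [Finsupp.single_apply]
  split_ifs with h
  · subst h; exact Hm.one _
  · exact Hm.zero _ _

/-- coefficient extraction by degree -/
def pc (a e : ℕ) (p : MvPolynomial σ K) : MvPolynomial σ K :=
  if a ≤ e then homogeneousComponent (e - a) p else 0

theorem coeff_pc (a e : ℕ) (p : MvPolynomial σ K) (m : σ →₀ ℕ) :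
    coeff m (pc a e p) = if m.degree + a = e then coeff m p else 0 := by
  classical
  unfold pc
  split_ifs with h1 h2 h2
  · rw [coeff_homogeneousComponent, if_pos (by omega)]
  · rw [coeff_homogeneousComponent, if_neg (by omega)]
  · omega
  · simp

theorem pc_add (a e : ℕ) (p q : MvPolynomial σ K) : pc a e (p + q) = pc a e p + pc a e q := by
  ext m; simp only [coeff_pc, coeff_add]; split_ifs <;> simp

theorem pc_zero (a e : ℕ) : pc a e (0 : MvPolynomial σ K) = 0 := by
  ext m; simp [coeff_pc]

theorem pc_Hm (a e : ℕ) (p : MvPolynomial σ K) : Hm (pc a e p) a e := by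
  intro m h
  rw [coeff_pc] at h
  by_contra h1
  simp [h1] at h

theorem pc_eq_self {a e : ℕ} {p : MvPolynomial σ K} (h : Hm p a e) : pc a e p = p := by
  ext m; rw [coeff_pc]
  split_ifs with h1
  · rfl
  · by_contra h2; exact h1 (h m (Ne.symm h2))

theorem pc_eq_zero {a e f : ℕ} {p : MvPolynomial σ K} (h : Hm p a f) (hne : f ≠ e) :
    pc a e p = 0 := by
  ext m; rw [coeff_pc]
  split_ifs with h1
  · by_contra h2; have := h m (by simpa using h2); omega
  · simp

/-- graded component of an element of a free module -/
def gcmp {A : Type} (da : A → ℕ) (e : ℕ) : (A →₀ MvPolynomial σ K) →+ (A →₀ MvPolynomial σ K) where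
  toFun x := Finsupp.onFinset x.support (fun a => pc (da a) e (x a)) (by
    intro a h
    rw [Finsupp.mem_support_iff]; intro h1; rw [h1, pc_zero] at h; exact h rfl)
  map_zero' := by ext a : 1; simp [pc_zero]
  map_add' x y := by ext a : 1; simp [pc_add]

theorem gcmp_apply {A : Type} (da : A → ℕ) (e : ℕ) (x : A →₀ MvPolynomial σ K) (a : A) :
    gcmp da e x a = pc (da a) e (x a) := rfl

theorem gcmp_self {A : Type} {da : A → ℕ} {e : ℕ} {x : A →₀ MvPolynomial σ K}
    (h : ∀ a, Hm (x a) (da a) e) : gcmp da e x = x := by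
  ext a : 1; rw [gcmp_apply, pc_eq_self (h a)]

theorem gcmp_ne {A : Type} {da : A → ℕ} {e f : ℕ} {x : A →₀ MvPolynomial σ K}
    (h : ∀ a, Hm (x a) (da a) f) (hne : f ≠ e) : gcmp da e x = 0 := by
  ext a : 1; rw [gcmp_apply, pc_eq_zero (h a) hne]; rfl

theorem Hm_monomial (m : σ →₀ ℕ) (r : K) (a : ℕ) : Hm (monomial m r) a (m.degree + a) := by
  classical
  intro m' h
  rw [coeff_monomial] at h
  have : m = m' := by by_contra h1; simp [h1] at h
  rw [this]

theorem map_gcmp {A B : Type} {da : A → ℕ} {db : B → ℕ}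
    {L : (A →₀ MvPolynomial σ K) →ₗ[MvPolynomial σ K] (B →₀ MvPolynomial σ K)}
    (hL : GrL da db L) (e : ℕ) (x : A →₀ MvPolynomial σ K) :
    L (gcmp da e x) = gcmp db e (L x) := by
  induction x using Finsupp.induction_linear with
  | zero => simp
  | add x y hx hy => simp only [map_add, hx, hy]
  | single a p =>
    induction p using MvPolynomial.induction_on' with
    | add p q hp hq => simp only [Finsupp.single_add, map_add, hp, hq]
    | monomial m r =>
      have h0 : Finsupp.single a (monomial m r : MvPolynomial σ K) =
          (monomial m r : MvPolynomial σ K) • Finsupp.single a 1 := by simp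
      have h1 : ∀ c, Hm (Finsupp.single a (monomial m r : MvPolynomial σ K) c) (da c)
          (m.degree + da a) := by
        intro c
        rw [h0]
        exact (Hm_monomial m r (da a)).mul (Hm_single da a c)
      have h2 : ∀ c, Hm (L (Finsupp.single a (monomial m r : MvPolynomial σ K)) c) (db c)
          (m.degree + da a) := by
        intro c
        rw [h0, map_smul]
        exact (Hm_monomial m r (da a)).mul (hL a c)
      by_cases he : m.degree + da a = e
      · subst he
        rw [gcmp_self h1, gcmp_self h2]
      · rw [gcmp_ne h1 he, gcmp_ne h2 he, map_zero]

/-- finite support of degrees: an element is the sum of its components -/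
theorem sum_gcmp {A : Type} [Finite A] (da : A → ℕ) (x : A →₀ MvPolynomial σ K) :
    ∃ N : ℕ, x = ∑ e ∈ Finset.range N, gcmp da e x := by
  classical
  have := Fintype.ofFinite A
  refine ⟨(∑ a, (∑ m ∈ (x a).support, (m.degree + da a))) + 1, ?_⟩
  ext a m
  rw [Finsupp.finsetSum_apply, coeff_sum]
  simp only [gcmp_apply, coeff_pc]
  rw [Finset.sum_ite_eq]
  split_ifs with h
  · rfl
  · by_contra hne
    apply h
    rw [Finset.mem_range]
    have h1 : m.degree + da a ≤ ∑ m ∈ (x a).support, (m.degree + da a) :=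
      Finset.single_le_sum (f := fun m : σ →₀ ℕ => m.degree + da a) (fun _ _ => Nat.zero_le _)
        (mem_support_iff.2 hne)
    have h2 : ∑ m ∈ (x a).support, (m.degree + da a) ≤
        ∑ a, (∑ m ∈ (x a).support, (m.degree + da a)) :=
      Finset.single_le_sum (f := fun a => ∑ m ∈ (x a).support, (m.degree + da a))
        (fun _ _ => Nat.zero_le _) (Finset.mem_univ a)
    omega

/-- graded lifting -/
theorem exists_lift {A B C : Type} {da : A → ℕ} {db : B → ℕ} {dc : C → ℕ}
    {L : (A →₀ MvPolynomial σ K) →ₗ[MvPolynomial σ K] (C →₀ MvPolynomial σ K)}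
    {D : (B →₀ MvPolynomial σ K) →ₗ[MvPolynomial σ K] (C →₀ MvPolynomial σ K)}
    (hL : GrL da dc L) (hD : GrL db dc D) (h : ∀ x, L x ∈ LinearMap.range D) :
    ∃ f : (A →₀ MvPolynomial σ K) →ₗ[MvPolynomial σ K] (B →₀ MvPolynomial σ K),
      GrL da db f ∧ ∀ x, D (f x) = L x := by
  have key : ∀ a, ∃ y : B →₀ MvPolynomial σ K, (∀ b, Hm (y b) (db b) (da a)) ∧
      D y = L (Finsupp.single a 1) := by
    intro a
    obtain ⟨y, hy⟩ := h (Finsupp.single a 1)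
    refine ⟨gcmp db (da a) y, fun b => pc_Hm _ _ _, ?_⟩
    rw [map_gcmp hD, hy, gcmp_self (hL a)]
  choose y hy1 hy2 using key
  refine ⟨Finsupp.linearCombination _ y, ?_, ?_⟩
  · intro a b
    simpa using hy1 a b
  · intro x
    have : D ∘ₗ Finsupp.linearCombination _ y = L := by
      ext a : 2
      simpa using hy2 a
    exact LinearMap.congr_fun this x

/-- ungraded lifting -/
theorem exists_lift' {A M N : Type} [AddCommGroup M] [Module (MvPolynomial σ K) M]
    [AddCommGroup N] [Module (MvPolynomial σ K) N]
    {L : (A →₀ MvPolynomial σ K) →ₗ[MvPolynomial σ K] N}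
    {D : M →ₗ[MvPolynomial σ K] N}
    (h : ∀ x, L x ∈ LinearMap.range D) :
    ∃ f : (A →₀ MvPolynomial σ K) →ₗ[MvPolynomial σ K] M, ∀ x, D (f x) = L x := by
  choose y hy using fun a => h (Finsupp.single a 1)
  refine ⟨Finsupp.linearCombination _ y, ?_⟩
  intro x
  have : D ∘ₗ Finsupp.linearCombination _ y = L := by
    ext a : 2
    simpa using hy a
  exact LinearMap.congr_fun this x

end basics

section uniq
variable {K σ : Type} [Field K]
open MinimalGradedFreeResolution

theorem R_mem {I : Ideal (MvPolynomial σ K)} (R : MinimalGradedFreeResolution I)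
    (x : R.ι 0 →₀ MvPolynomial σ K) : R.ε x ∈ I := R.range_ε.le ⟨x, rfl⟩

theorem R_grl {I : Ideal (MvPolynomial σ K)} (R : MinimalGradedFreeResolution I) (i : ℕ) :
    GrL (R.deg (i + 1)) (R.deg i) (R.d i) := fun b c => (Hm_iff _ _ _).1 (R.homog_d i b c)

theorem R_grl0 {I : Ideal (MvPolynomial σ K)} (R : MinimalGradedFreeResolution I) :
    GrL (R.deg 0) (fun _ : Unit => 0) (Finsupp.lsingle () ∘ₗ R.ε) := by
  intro b c
  have := (Hm_zero_iff _ _).1 (R.homog_ε b)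
  simpa using this

theorem cc_map {A B : Type} [Finite A]
    {L : (A →₀ MvPolynomial σ K) →ₗ[MvPolynomial σ K] (B →₀ MvPolynomial σ K)}
    (h : ∀ a b, constantCoeff (L (Finsupp.single a 1) b) = 0) (x : A →₀ MvPolynomial σ K) (b : B) :
    constantCoeff (L x b) = 0 := by
  have := Fintype.ofFinite A
  rw [map_apply_eq, map_sum]
  exact Finset.sum_eq_zero fun a _ => by rw [map_mul, h, mul_zero]

theorem cc_map' {A B : Type} [Finite A]
    (L : (A →₀ MvPolynomial σ K) →ₗ[MvPolynomial σ K] (B →₀ MvPolynomial σ K))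
    (x : A →₀ MvPolynomial σ K) (h : ∀ a, constantCoeff (x a) = 0) (b : B) :
    constantCoeff (L x b) = 0 := by
  have := Fintype.ofFinite A
  rw [map_apply_eq, map_sum]
  exact Finset.sum_eq_zero fun a _ => by rw [map_mul, h, zero_mul]

theorem R_cc {I : Ideal (MvPolynomial σ K)} (R : MinimalGradedFreeResolution I) (i : ℕ)
    (x : R.ι (i + 1) →₀ MvPolynomial σ K) (c : R.ι i) : constantCoeff (R.d i x c) = 0 := by
  have := R.finite (i + 1)
  exact cc_map (R.minimal i) x c

theorem exists_chain {A B : Ideal (MvPolynomial σ K)} (R : MinimalGradedFreeResolution A)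
    (R' : MinimalGradedFreeResolution B) (h : A ≤ B) :
    ∃ f : ∀ i, (R.ι i →₀ MvPolynomial σ K) →ₗ[MvPolynomial σ K] (R'.ι i →₀ MvPolynomial σ K),
      (∀ i, GrL (R.deg i) (R'.deg i) (f i)) ∧ (∀ x, R'.ε (f 0 x) = R.ε x) ∧
      ∀ i x, R'.d i (f (i + 1) x) = f i (R.d i x) := by
  have h0 : ∃ f : (R.ι 0 →₀ MvPolynomial σ K) →ₗ[MvPolynomial σ K] (R'.ι 0 →₀ MvPolynomial σ K),
      GrL (R.deg 0) (R'.deg 0) f ∧ ∀ x, R'.ε (f x) = R.ε x := by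
    obtain ⟨f, hf1, hf2⟩ := exists_lift (R_grl0 R) (R_grl0 R') (by
      intro x
      have hx : R.ε x ∈ LinearMap.range R'.ε := by
        rw [R'.range_ε]; exact h (R_mem R x)
      obtain ⟨y, hy⟩ := hx
      exact ⟨y, by simp [hy]⟩)
    refine ⟨f, hf1, fun x => ?_⟩
    have := hf2 x
    simpa using this
  obtain ⟨f0, hf0, hf0'⟩ := h0
  let St : ℕ → Type := fun i =>
    {f : (R.ι i →₀ MvPolynomial σ K) →ₗ[MvPolynomial σ K] (R'.ι i →₀ MvPolynomial σ K) //
      GrL (R.deg i) (R'.deg i) f ∧ ∀ x, f (R.d i x) ∈ LinearMap.range (R'.d i)}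
  have step : ∀ i (f : St i), ∃ g : St (i + 1), ∀ x, R'.d i (g.1 x) = f.1 (R.d i x) := by
    intro i f
    have := R.finite i
    obtain ⟨g, hg1, hg2⟩ := exists_lift (L := f.1 ∘ₗ R.d i) (f.2.1.comp (R_grl R i)) (R_grl R' i)
      (fun x => f.2.2 x)
    refine ⟨⟨g, hg1, ?_⟩, hg2⟩
    intro x
    rw [← R'.exact_d, LinearMap.mem_ker, hg2]
    have : R.d (i + 1) x ∈ LinearMap.ker (R.d i) := by rw [R.exact_d]; exact ⟨x, rfl⟩
    simp [LinearMap.mem_ker.1 this]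
  choose nxt hnxt using step
  let s0 : St 0 := ⟨f0, hf0, by
    intro x
    rw [← R'.exact_ε, LinearMap.mem_ker, hf0']
    have : R.d 0 x ∈ LinearMap.ker R.ε := by rw [R.exact_ε]; exact ⟨x, rfl⟩
    exact this⟩
  let sq : ∀ i, St i := fun i => Nat.rec s0 nxt i
  exact ⟨fun i => (sq i).1, fun i => (sq i).2.1, hf0', fun i x => hnxt i (sq i) x⟩

theorem chain_cc {I : Ideal (MvPolynomial σ K)} (R : MinimalGradedFreeResolution I)
    (p : ∀ i, (R.ι i →₀ MvPolynomial σ K) →ₗ[MvPolynomial σ K] (R.ι i →₀ MvPolynomial σ K))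
    (h0 : ∀ x, R.ε (p 0 x) = 0) (h1 : ∀ i x, R.d i (p (i + 1) x) = p i (R.d i x)) (i : ℕ)
    (x : R.ι i →₀ MvPolynomial σ K) (c : R.ι i) : constantCoeff (p i x c) = 0 := by
  have base : ∃ h : (R.ι 0 →₀ MvPolynomial σ K) →ₗ[MvPolynomial σ K] (R.ι 1 →₀ MvPolynomial σ K),
      ∀ x, R.d 0 (h x) = p 0 x := by
    apply exists_lift'
    intro x
    rw [← R.exact_ε]; exact h0 x
  have step : ∀ i (q : (R.ι i →₀ MvPolynomial σ K) →ₗ[MvPolynomial σ K]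
        (R.ι i →₀ MvPolynomial σ K))
      (h : (R.ι i →₀ MvPolynomial σ K) →ₗ[MvPolynomial σ K] (R.ι (i + 1) →₀ MvPolynomial σ K)),
      (∀ x, R.d i (h (R.d i x)) = p i (R.d i x)) →
      ∃ h' : (R.ι (i + 1) →₀ MvPolynomial σ K) →ₗ[MvPolynomial σ K]
        (R.ι (i + 2) →₀ MvPolynomial σ K),
        ∀ x, R.d (i + 1) (h' x) = p (i + 1) x - h (R.d i x) := by
    intro i _ h hh
    refine exists_lift' (L := p (i + 1) - h ∘ₗ R.d i) ?_
    intro x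
    rw [← R.exact_d]
    simp [hh, h1]
  have all : ∀ i, ∃ h : (R.ι i →₀ MvPolynomial σ K) →ₗ[MvPolynomial σ K]
      (R.ι (i + 1) →₀ MvPolynomial σ K),
      (∀ x, R.d i (h (R.d i x)) = p i (R.d i x)) ∧
      (∀ x c, constantCoeff (p i x c) = 0) := by
    intro i
    induction i with
    | zero =>
      obtain ⟨h, hh⟩ := base
      refine ⟨h, fun x => hh _, fun x c => ?_⟩
      rw [← hh]; exact R_cc R 0 _ c
    | succ i ih =>
      obtain ⟨h, hh, _⟩ := ih
      obtain ⟨h', hh'⟩ := step i (p i) h hh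
      refine ⟨h', fun x => ?_, fun x c => ?_⟩
      · have : R.d i (R.d (i + 1) x) = 0 := by
          have : R.d (i + 1) x ∈ LinearMap.ker (R.d i) := by rw [R.exact_d]; exact ⟨x, rfl⟩
          exact this
        rw [hh', this, map_zero, sub_zero]
      · have e1 : p (i + 1) x = R.d (i + 1) (h' x) + h (R.d i x) := by rw [hh']; abel
        have := R.finite i
        rw [e1, Finsupp.add_apply, map_add, R_cc, cc_map' h _ (R_cc R i x), add_zero]
  obtain ⟨_, _, h⟩ := all i
  exact h x c

theorem betti_le {I : Ideal (MvPolynomial σ K)} (R R' : MinimalGradedFreeResolution I) (i j : ℕ) :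
    R.betti i j ≤ R'.betti i j := by
  classical
  obtain ⟨f, hf, hf0, hf1⟩ := exists_chain R R' le_rfl
  obtain ⟨g, hg, hg0, hg1⟩ := exists_chain R' R le_rfl
  have key := chain_cc R (fun i => g i ∘ₗ f i - LinearMap.id) (by simp [hg0, hf0])
    (by intro i x; simp [hg1, hf1]) i
  have := R.finite i
  have := R'.finite i
  have := Fintype.ofFinite (R.ι i)
  have := Fintype.ofFinite (R'.ι i)
  unfold MinimalGradedFreeResolution.betti
  let M : Matrix {b : R'.ι i // R'.deg i b = j} {b : R.ι i // R.deg i b = j} K :=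
    fun c b => constantCoeff (f i (Finsupp.single b.1 1) c.1)
  let N : Matrix {b : R.ι i // R.deg i b = j} {b : R'.ι i // R'.deg i b = j} K :=
    fun b c => constantCoeff (g i (Finsupp.single c.1 1) b.1)
  have hNM : N * M = 1 := by
    ext b b2
    rw [Matrix.mul_apply]
    have h1 := key (Finsupp.single b2.1 1) b.1
    simp only [LinearMap.sub_apply, LinearMap.comp_apply, LinearMap.id_apply,
      Finsupp.sub_apply, map_sub] at h1
    rw [map_apply_eq, map_sum] at h1
    have h2 : ∑ a, constantCoeff ((f i (Finsupp.single b2.1 1)) a *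
        (g i (Finsupp.single a 1)) b.1) = ∑ c : {b : R'.ι i // R'.deg i b = j}, N b c * M c b2 := by
      rw [← Finset.sum_filter_add_sum_filter_not Finset.univ (fun a => R'.deg i a = j)]
      rw [Finset.sum_eq_zero (s := Finset.filter (fun a => ¬ R'.deg i a = j) Finset.univ), add_zero]
      · rw [← Finset.sum_subtype_of_mem (p := fun a => R'.deg i a = j)]
        · refine Finset.sum_bij (fun a _ => a) ?_ ?_ ?_ ?_
          · simp
          · simp
          · intro a _; exact ⟨a, by simp [a.2], rfl⟩
          · intro a _; simp [N, M, mul_comm]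
        · simp
      · intro a ha
        simp only [Finset.mem_filter, Finset.mem_univ, true_and] at ha
        rw [map_mul, (hf i b2.1 a).cc (by rw [b2.2]; exact ha), zero_mul]
    rw [← h2, sub_eq_zero.1 h1, Finsupp.single_apply, Matrix.one_apply]
    by_cases hb : b = b2
    · simp [hb]
    · have : ¬ b2.1 = b.1 := fun h => hb (Subtype.ext h.symm)
      simp [hb, this]
  have hinj : Function.Injective (Matrix.toLin' M) := by
    intro x y hxy
    have h1 : Matrix.toLin' N (Matrix.toLin' M x) = Matrix.toLin' N (Matrix.toLin' M y) := by
      rw [hxy]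
    rw [← LinearMap.comp_apply, ← LinearMap.comp_apply, ← Matrix.toLin'_mul, hNM] at h1
    simpa using h1
  have := LinearMap.finrank_le_finrank_of_injective hinj
  simpa [Nat.card_eq_fintype_card] using this

theorem bettiNumber_eq {I : Ideal (MvPolynomial σ K)} (R : MinimalGradedFreeResolution I)
    (i j : ℕ) : bettiNumber I i j = R.betti i j := by
  have : {b | ∃ R : MinimalGradedFreeResolution I, R.betti i j = b} = {R.betti i j} := by
    ext b
    constructor
    · rintro ⟨R', rfl⟩
      exact le_antisymm (betti_le _ _ _ _) (betti_le _ _ _ _)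
    · rintro rfl; exact ⟨R, rfl⟩
  rw [bettiNumber, this, csSup_singleton]

theorem betti_ne {I : Ideal (MvPolynomial σ K)} (R : MinimalGradedFreeResolution I)
    (i j : ℕ) : bettiNumber I i j ≠ 0 ↔ ∃ b : R.ι i, R.deg i b = j := by
  have := R.finite i
  rw [bettiNumber_eq R, MinimalGradedFreeResolution.betti, Nat.card_ne_zero]
  constructor
  · rintro ⟨⟨b⟩, _⟩; exact ⟨b.1, b.2⟩
  · rintro ⟨b, hb⟩; exact ⟨⟨⟨b, hb⟩⟩, inferInstance⟩

theorem reg_eq {I : Ideal (MvPolynomial σ K)} (R : MinimalGradedFreeResolution I) :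
    reg I = sSup {r | ∃ i, ∃ b : R.ι i, R.deg i b = i + r} := by
  unfold reg
  congr 1
  ext r
  constructor
  · rintro ⟨i, j, h, rfl⟩
    exact ⟨i, (betti_ne R _ _).1 h⟩
  · rintro ⟨i, h⟩
    exact ⟨i, _, (betti_ne R _ _).2 h, rfl⟩

end uniq

section exist
variable {K σ : Type} [Field K]

/-- graded submodules of a graded free module -/
def GrSub {A : Type} (da : A → ℕ) (N : Submodule (MvPolynomial σ K) (A →₀ MvPolynomial σ K)) :
    Prop := ∀ x ∈ N, ∀ e, gcmp da e x ∈ N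

theorem exists_gens [Finite σ] {B : Type} [Finite B] (db : B → ℕ)
    (N : Submodule (MvPolynomial σ K) (B →₀ MvPolynomial σ K)) (hN : GrSub db N) :
    ∃ k : ℕ, ∃ (b : Fin k → (B →₀ MvPolynomial σ K)) (da : Fin k → ℕ),
      (∀ i c, Hm (b i c) (db c) (da i)) ∧ Submodule.span _ (Set.range b) = N := by
  classical
  obtain ⟨s, hs⟩ := (IsNoetherian.noetherian N : N.FG)
  choose M hM using fun x : B →₀ MvPolynomial σ K => sum_gcmp db x
  let T : Finset (B →₀ MvPolynomial σ K) :=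
    s.biUnion fun x => (Finset.range (M x)).image fun e => gcmp db e x
  have hT : ∀ t : T, ∃ e, ∀ c, Hm (t.1 c) (db c) e := by
    rintro ⟨t, ht⟩
    simp only [T, Finset.mem_biUnion, Finset.mem_image] at ht
    obtain ⟨x, _, e, _, rfl⟩ := ht
    exact ⟨e, fun c => pc_Hm _ _ _⟩
  choose dt hdt using hT
  let eqv := T.equivFin
  refine ⟨T.card, fun i => (eqv.symm i).1, fun i => dt (eqv.symm i), fun i c => hdt _ c, ?_⟩
  have hr : Set.range (fun i => (eqv.symm i).1) = (T : Set (B →₀ MvPolynomial σ K)) := by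
    ext y
    constructor
    · rintro ⟨i, rfl⟩; exact (eqv.symm i).2
    · intro hy; exact ⟨eqv ⟨y, hy⟩, by simp⟩
  rw [hr]
  apply le_antisymm
  · rw [Submodule.span_le]
    intro t ht
    simp only [T, Finset.coe_biUnion, Set.mem_iUnion, Finset.coe_image, Set.mem_image] at ht
    obtain ⟨x, hx, e, _, rfl⟩ := ht
    apply hN
    rw [← hs]
    exact Submodule.subset_span hx
  · rw [← hs, Submodule.span_le]
    intro x hx
    rw [hM x]
    apply Submodule.sum_mem
    intro e he
    apply Submodule.subset_span
    simp only [T, Finset.coe_biUnion, Set.mem_iUnion, Finset.coe_image, Set.mem_image]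
    exact ⟨x, hx, e, he, rfl⟩

theorem exists_cover [Finite σ] {B : Type} [Finite B] (db : B → ℕ)
    (N : Submodule (MvPolynomial σ K) (B →₀ MvPolynomial σ K)) (hN : GrSub db N) :
    ∃ k : ℕ, ∃ (da : Fin k → ℕ)
      (L : (Fin k →₀ MvPolynomial σ K) →ₗ[MvPolynomial σ K] (B →₀ MvPolynomial σ K)),
      GrL da db L ∧ LinearMap.range L = N ∧
      ∀ x ∈ LinearMap.ker L, ∀ a, constantCoeff (x a) = 0 := by
  classical
  have hex := exists_gens db N hN
  obtain ⟨b, da, hb, hspan⟩ := Nat.find_spec hex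
  have hmin := fun m => Nat.find_min hex (m := m)
  generalize Nat.find hex = k at *
  have hL : GrL da db (Finsupp.linearCombination (MvPolynomial σ K) b) := by
    intro i c; simpa using hb i c
  refine ⟨k, da, Finsupp.linearCombination _ b, hL, ?_, ?_⟩
  · rw [Finsupp.range_linearCombination, hspan]
  · intro x hx a
    by_contra hne
    cases k with
    | zero => exact a.elim0
    | succ k =>
      apply hmin k (by omega)
      refine ⟨fun i => b (a.succAbove i), fun i => da (a.succAbove i), fun i c => hb _ c, ?_⟩
      have hy : Finsupp.linearCombination (MvPolynomial σ K) b (gcmp da (da a) x) = 0 := by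
        rw [map_gcmp hL, LinearMap.mem_ker.1 hx, map_zero]
      have hya : gcmp da (da a) x a = C (constantCoeff (x a)) := by
        ext m
        rw [gcmp_apply, coeff_pc, coeff_C]
        by_cases hm : m = 0
        · subst hm; simp [constantCoeff_eq]
        · rw [if_neg (Ne.symm hm), if_neg]
          intro h
          apply hm
          rw [← Finsupp.degree_eq_zero_iff]; omega
      rw [Finsupp.linearCombination_apply, Finsupp.sum_fintype _ _ (by simp),
        Fin.sum_univ_succAbove _ a, hya] at hy
      have hba : b a ∈ Submodule.span (MvPolynomial σ K) (Set.range fun i => b (a.succAbove i)) := by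
        have h1 : b a = -(C (constantCoeff (x a))⁻¹ : MvPolynomial σ K) •
            ∑ i, (gcmp da (da a) x) (a.succAbove i) • b (a.succAbove i) := by
          rw [eq_neg_of_add_eq_zero_right hy, neg_smul, smul_neg, neg_neg, smul_smul, ← C_mul,
            inv_mul_cancel₀ hne, C_1, one_smul]
        rw [h1]
        apply Submodule.smul_mem
        exact Submodule.sum_mem _ fun i _ => Submodule.smul_mem _ _ (Submodule.subset_span ⟨i, rfl⟩)
      rw [← hspan]
      apply le_antisymm
      · apply Submodule.span_mono
        rintro _ ⟨i, rfl⟩; exact ⟨_, rfl⟩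
      · rw [Submodule.span_le]
        rintro _ ⟨i, rfl⟩
        by_cases hi : i = a
        · rw [hi]; exact hba
        · obtain ⟨j, rfl⟩ := Fin.exists_succAbove_eq hi
          exact Submodule.subset_span ⟨j, rfl⟩

/-- state for the recursive construction of minimal resolutions -/
structure RSt (K σ : Type) [Field K] where
  k : ℕ
  dg : Fin k → ℕ
  N : Submodule (MvPolynomial σ K) (Fin k →₀ MvPolynomial σ K)
  gr : GrSub dg N

theorem RSt_step [Finite σ] (s : RSt K σ) : ∃ t : RSt K σ,
    ∃ L : (Fin t.k →₀ MvPolynomial σ K) →ₗ[MvPolynomial σ K] (Fin s.k →₀ MvPolynomial σ K),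
      GrL t.dg s.dg L ∧ LinearMap.range L = s.N ∧ LinearMap.ker L = t.N ∧
      ∀ x ∈ t.N, ∀ a, constantCoeff (x a) = 0 := by
  obtain ⟨k, da, L, h1, h2, h3⟩ := exists_cover s.dg s.N s.gr
  refine ⟨⟨k, da, LinearMap.ker L, ?_⟩, L, h1, h2, rfl, h3⟩
  intro x hx e
  rw [LinearMap.mem_ker, map_gcmp h1, LinearMap.mem_ker.1 hx, map_zero]

theorem exists_resolution [Finite σ] (I : Ideal (MvPolynomial σ K))
    (hI : ∀ p ∈ I, ∀ e, pc 0 e p ∈ I) : Nonempty (MinimalGradedFreeResolution I) := by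
  choose nx L h1 h2 h3 h4 using RSt_step (K := K) (σ := σ)
  let s0 : RSt K σ := ⟨1, fun _ => 0, Submodule.comap (Finsupp.lapply 0) I, by
    intro x hx e
    exact hI _ hx e⟩
  let sq : ℕ → RSt K σ := fun i => Nat.rec s0 (fun _ s => nx s) i
  exact ⟨{
    ι := fun i => Fin (sq (i + 1)).k
    finite := fun i => inferInstance
    deg := fun i => (sq (i + 1)).dg
    d := fun i => L (sq (i + 1))
    ε := Finsupp.lapply 0 ∘ₗ L s0
    range_ε := by
      rw [LinearMap.range_comp, h2]
      apply Submodule.map_comap_eq_of_surjective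
      intro p
      exact ⟨Finsupp.single 0 p, by simp⟩
    exact_ε := by
      rw [h2 (sq (0 + 1))]
      change _ = (nx s0).N
      rw [← h3 s0]
      ext x
      simp only [LinearMap.mem_ker, LinearMap.comp_apply, Finsupp.lapply_apply]
      constructor
      · intro h
        refine Finsupp.ext fun i => ?_
        rw [show i = 0 from Subsingleton.elim (α := Fin 1) _ _]
        exact h
      · intro h; rw [h]; rfl
    exact_d := by
      intro i
      rw [h2 (sq (i + 2)), h3 (sq (i + 1))]
    homog_ε := by
      intro b
      exact (Hm_zero_iff _ _).2 (h1 s0 b 0)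
    homog_d := by
      intro i b c
      exact (Hm_iff _ _ _).2 (h1 (sq (i + 1)) b c)
    minimal := by
      intro i b c
      apply h4 (sq i)
      change _ ∈ (sq (i + 1)).N
      rw [← h2 (sq (i + 1))]
      exact ⟨_, rfl⟩ }⟩

end exist

section cone
variable {K σ : Type} [Field K]

/-- shifted index types -/
abbrev pI (ι : ℕ → Type) : ℕ → Type
  | 0 => Empty
  | i + 1 => ι i

/-- degrees for the shifted index types -/
abbrev pdeg {ι : ℕ → Type} (deg : ∀ i, ι i → ℕ) : ∀ i, pI ι i → ℕ
  | 0 => fun _ => 0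
  | i + 1 => fun b => deg i b + 1

/-- shifted differential -/
abbrev pd {ι : ℕ → Type} (d : ∀ i, (ι (i + 1) →₀ MvPolynomial σ K) →ₗ[MvPolynomial σ K]
      (ι i →₀ MvPolynomial σ K)) : ∀ i, (ι i →₀ MvPolynomial σ K) →ₗ[MvPolynomial σ K]
      (pI ι i →₀ MvPolynomial σ K)
  | 0 => 0
  | i + 1 => d i

/-- splitting of a free module on a triple sum -/
def e3 (K σ A B C : Type) [Field K] : ((A ⊕ B ⊕ C) →₀ MvPolynomial σ K) ≃ₗ[MvPolynomial σ K]
    (A →₀ MvPolynomial σ K) × (B →₀ MvPolynomial σ K) × (C →₀ MvPolynomial σ K) :=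
  (Finsupp.sumFinsuppLEquivProdFinsupp (MvPolynomial σ K)).trans
    ((LinearEquiv.refl _ _).prodCongr (Finsupp.sumFinsuppLEquivProdFinsupp (MvPolynomial σ K)))

section e3
variable {A B C : Type}

theorem e3_inl (a : A) (p : MvPolynomial σ K) :
    e3 K σ A B C (Finsupp.single (Sum.inl a) p) = (Finsupp.single a p, 0, 0) := by
  classical
  refine Prod.ext ?_ (Prod.ext ?_ ?_) <;> ext x : 1 <;>
    simp [e3, Finsupp.single_apply]

theorem e3_inm (a : B) (p : MvPolynomial σ K) :
    e3 K σ A B C (Finsupp.single (Sum.inr (Sum.inl a)) p) = (0, Finsupp.single a p, 0) := by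
  classical
  refine Prod.ext ?_ (Prod.ext ?_ ?_) <;> ext x : 1 <;>
    simp [e3, Finsupp.single_apply]

theorem e3_inr (a : C) (p : MvPolynomial σ K) :
    e3 K σ A B C (Finsupp.single (Sum.inr (Sum.inr a)) p) = (0, 0, Finsupp.single a p) := by
  classical
  refine Prod.ext ?_ (Prod.ext ?_ ?_) <;> ext x : 1 <;>
    simp [e3, Finsupp.single_apply]

theorem e3s_inl (z) (a : A) : (e3 K σ A B C).symm z (Sum.inl a) = z.1 a := by
  simp [e3]
theorem e3s_inm (z) (a : B) : (e3 K σ A B C).symm z (Sum.inr (Sum.inl a)) = z.2.1 a := by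
  simp [e3]
theorem e3s_inr (z) (a : C) : (e3 K σ A B C).symm z (Sum.inr (Sum.inr a)) = z.2.2 a := by
  simp [e3]

end e3

/-- generic cone block map -/
def blk {A A' B B' C' : Type}
    (dA : (A →₀ MvPolynomial σ K) →ₗ[MvPolynomial σ K] (A' →₀ MvPolynomial σ K))
    (dB : (B →₀ MvPolynomial σ K) →ₗ[MvPolynomial σ K] (B' →₀ MvPolynomial σ K))
    (ph : (A' →₀ MvPolynomial σ K) →ₗ[MvPolynomial σ K] (B' →₀ MvPolynomial σ K))
    (dC : (A' →₀ MvPolynomial σ K) →ₗ[MvPolynomial σ K] (C' →₀ MvPolynomial σ K))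
    (x : MvPolynomial σ K) :
    ((A →₀ MvPolynomial σ K) × (B →₀ MvPolynomial σ K) × (A' →₀ MvPolynomial σ K))
      →ₗ[MvPolynomial σ K]
    ((A' →₀ MvPolynomial σ K) × (B' →₀ MvPolynomial σ K) × (C' →₀ MvPolynomial σ K)) where
  toFun z := (dA z.1 + x • z.2.2, dB z.2.1 - ph z.2.2, - dC z.2.2)
  map_add' z w := by
    refine Prod.ext ?_ (Prod.ext ?_ ?_) <;> simp <;> abel
  map_smul' r z := by
    refine Prod.ext ?_ (Prod.ext ?_ ?_) <;> simp [smul_sub, smul_comm x r]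

theorem exists_cone {A B T : Ideal (MvPolynomial σ K)} (F : MinimalGradedFreeResolution A)
    (H : MinimalGradedFreeResolution B) (hAB : A ≤ B) (v : σ)
    (hx : ∀ b, X v * b ∈ A → b ∈ A)
    (hT : ∀ p, p ∈ T ↔ ∃ a ∈ A, ∃ b ∈ B, p = a + X v * b)
    (hdeg : ∀ i (b : F.ι i) (c : H.ι i), H.deg i c ≠ F.deg i b) :
    ∃ R : MinimalGradedFreeResolution T, ∀ i r, (∃ b, R.deg i b = r) ↔
      (∃ b, F.deg i b = r) ∨ (∃ b, H.deg i b + 1 = r) ∨ (∃ b, pdeg F.deg i b = r) := by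
  classical
  obtain ⟨f, hf, hf0, hf1⟩ := exists_chain F H hAB
  have hX0 : (X v : MvPolynomial σ K) ≠ 0 := X_ne_zero v
  have hpd : ∀ i a b, Hm (pd F.d i (Finsupp.single a 1) b) (pdeg F.deg i b) (F.deg i a + 1) := by
    intro i a b
    cases i with
    | zero => exact b.elim
    | succ i =>
      intro m hm
      have := R_grl F i a b m hm
      change m.degree + (F.deg i b + 1) = _
      omega
  have hpc : ∀ i a b, constantCoeff (pd F.d i (Finsupp.single a 1) b) = 0 := by
    intro i a b
    cases i with
    | zero => exact b.elim
    | succ i => exact F.minimal i a b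
  have hsh : ∀ (p : MvPolynomial σ K) a e, Hm p a e → Hm p (a + 1) (e + 1) := by
    intro p a e h m hm
    have := h m hm
    omega
  have fcc : ∀ i a b, constantCoeff (f i (Finsupp.single a 1) b) = 0 :=
    fun i a b => (hf i a b).cc (hdeg i a b)
  have hdd0 : ∀ x, F.ε (F.d 0 x) = 0 := fun x => F.exact_ε.ge ⟨x, rfl⟩
  have hdd : ∀ i x, F.d i (F.d (i + 1) x) = 0 := fun i x => (F.exact_d i).ge ⟨x, rfl⟩
  have hee0 : ∀ x, H.ε (H.d 0 x) = 0 := fun x => H.exact_ε.ge ⟨x, rfl⟩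
  have hee : ∀ i x, H.d i (H.d (i + 1) x) = 0 := fun i x => (H.exact_d i).ge ⟨x, rfl⟩
  have hpdd : ∀ i x, pd F.d i (F.d i x) = 0 := by
    intro i x
    cases i with
    | zero => rfl
    | succ i => exact hdd i x
  let ep : ((F.ι 0 →₀ MvPolynomial σ K) × (H.ι 0 →₀ MvPolynomial σ K) ×
      (pI F.ι 0 →₀ MvPolynomial σ K)) →ₗ[MvPolynomial σ K] MvPolynomial σ K :=
    F.ε ∘ₗ LinearMap.fst _ _ _ + (X v : MvPolynomial σ K) • H.ε ∘ₗ LinearMap.fst _ _ _ ∘ₗ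
      LinearMap.snd _ _ _
  have hep : ∀ z, ep z = F.ε z.1 + X v * H.ε z.2.1 := fun z => rfl
  let DD : ∀ i, ((F.ι (i + 1) →₀ MvPolynomial σ K) × (H.ι (i + 1) →₀ MvPolynomial σ K) ×
      (pI F.ι (i + 1) →₀ MvPolynomial σ K)) →ₗ[MvPolynomial σ K]
      ((F.ι i →₀ MvPolynomial σ K) × (H.ι i →₀ MvPolynomial σ K) ×
      (pI F.ι i →₀ MvPolynomial σ K)) := fun i => blk (F.d i) (H.d i) (f i) (pd F.d i) (X v)
  have hDD : ∀ i z, DD i z =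
    (F.d i z.1 + (X v : MvPolynomial σ K) • z.2.2, H.d i z.2.1 - f i z.2.2, - pd F.d i z.2.2) :=
    fun i z => rfl
  have sm : ∀ {M N : Type} [AddCommGroup M] [Module (MvPolynomial σ K) M] [AddCommGroup N]
      [Module (MvPolynomial σ K) N] (L : M →ₗ[MvPolynomial σ K] N) (p : MvPolynomial σ K) (x : M),
      L (p • x) = p • L x := fun L p x => map_smul L p x
  refine ⟨{
    ι := fun i => F.ι i ⊕ H.ι i ⊕ pI F.ι i
    finite := ?_
    deg := fun i => Sum.elim (F.deg i) (Sum.elim (fun b => H.deg i b + 1) (pdeg F.deg i))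
    d := fun i => (e3 K σ _ _ _).symm.toLinearMap ∘ₗ DD i ∘ₗ
      (e3 K σ (F.ι (i + 1)) (H.ι (i + 1)) (pI F.ι (i + 1))).toLinearMap
    ε := ep ∘ₗ (e3 K σ _ _ _).toLinearMap
    range_ε := ?_
    exact_ε := ?_
    exact_d := ?_
    homog_ε := ?_
    homog_d := ?_
    minimal := ?_ }, ?_⟩
  · intro i
    have := F.finite i
    have := H.finite i
    have : Finite (pI F.ι i) := by
      cases i with
      | zero => exact inferInstanceAs (Finite Empty)
      | succ i => exact F.finite i
    infer_instance
  · ext p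
    rw [hT]
    constructor
    · rintro ⟨z, rfl⟩
      refine ⟨_, R_mem F (e3 K σ _ _ _ z).1, _, R_mem H (e3 K σ _ _ _ z).2.1, ?_⟩
      simp [hep]
    · rintro ⟨a, ha, b, hb, rfl⟩
      obtain ⟨a, rfl⟩ := F.range_ε.ge ha
      obtain ⟨b, rfl⟩ := H.range_ε.ge hb
      exact ⟨(e3 K σ _ _ _).symm (a, b, 0), by simp [hep]⟩
  · ext z
    obtain ⟨⟨a, b, c⟩, rfl⟩ := (e3 K σ _ _ _).symm.surjective z
    constructor
    · intro h
      have h : F.ε a + X v * H.ε b = 0 := by simpa [hep] using h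
      have h1 : H.ε b ∈ A := by
        apply hx
        rw [eq_neg_of_add_eq_zero_right h]
        exact A.neg_mem (R_mem F a)
      obtain ⟨c', hc'⟩ := F.range_ε.ge h1
      have h2 : b - f 0 c' ∈ LinearMap.ker H.ε := by
        rw [LinearMap.mem_ker, map_sub, hf0, hc', sub_self]
      obtain ⟨b', hb'⟩ := H.exact_ε.le h2
      have h3 : a + (X v : MvPolynomial σ K) • c' ∈ LinearMap.ker F.ε := by
        rw [LinearMap.mem_ker, map_add, sm, hc', smul_eq_mul, h]
      obtain ⟨a', ha'⟩ := F.exact_ε.le h3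
      refine ⟨(e3 K σ _ _ _).symm (a', b', -c'), ?_⟩
      simp only [LinearMap.comp_apply, LinearEquiv.coe_coe, LinearEquiv.apply_symm_apply, hDD]
      congr 1
      refine Prod.ext ?_ (Prod.ext ?_ ?_)
      · simp [ha']
      · simp [hb']
      · ext x : 1; exact x.elim
    · rintro ⟨w, hw⟩
      obtain ⟨⟨a', b', c'⟩, rfl⟩ := (e3 K σ _ _ _).symm.surjective w
      rw [← hw]
      simp only [LinearMap.mem_ker, LinearMap.comp_apply, LinearEquiv.coe_coe,
        LinearEquiv.apply_symm_apply, hDD, hep, map_add, map_sub, sm, hdd0, hee0, hf0, smul_eq_mul]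
      ring
  · intro i
    ext z
    obtain ⟨⟨a, b, c⟩, rfl⟩ := (e3 K σ _ _ _).symm.surjective z
    change F.ι i →₀ MvPolynomial σ K at c
    constructor
    · intro h
      have h : DD i (a, b, c) = 0 := by
        have h' := congrArg (e3 K σ _ _ _) (LinearMap.mem_ker.1 h)
        simpa only [LinearMap.comp_apply, LinearEquiv.coe_coe, LinearEquiv.apply_symm_apply,
          map_zero] using h'
      rw [hDD] at h
      have ha : F.d i a + (X v : MvPolynomial σ K) • c = 0 := congrArg Prod.fst h
      have hb : H.d i b - f i c = 0 := congrArg (fun z => z.2.1) h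
      have hc : c ∈ LinearMap.range (F.d i) := by
        cases i with
        | zero =>
          rw [← F.exact_ε, LinearMap.mem_ker]
          have h1 := congrArg F.ε ha
          rw [map_add, hdd0, zero_add, sm, map_zero, smul_eq_mul] at h1
          exact (mul_eq_zero.1 h1).resolve_left hX0
        | succ i =>
          rw [← F.exact_d, LinearMap.mem_ker]
          have h1 := congrArg (F.d i) ha
          rw [map_add, hdd, zero_add, sm, map_zero] at h1
          exact (smul_eq_zero.1 h1).resolve_left hX0
      obtain ⟨c', rfl⟩ := hc
      have h2 : b - f (i + 1) c' ∈ LinearMap.ker (H.d i) := by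
        rw [LinearMap.mem_ker, map_sub, hf1, hb]
      obtain ⟨b', hb'⟩ := (H.exact_d i).le h2
      have h3 : a + (X v : MvPolynomial σ K) • c' ∈ LinearMap.ker (F.d i) := by
        rw [LinearMap.mem_ker, map_add, sm, ha]
      obtain ⟨a', ha'⟩ := (F.exact_d i).le h3
      refine ⟨(e3 K σ _ _ _).symm (a', b', -c'), ?_⟩
      simp only [LinearMap.comp_apply, LinearEquiv.coe_coe, LinearEquiv.apply_symm_apply, hDD]
      congr 1
      refine Prod.ext ?_ (Prod.ext ?_ ?_)
      · simp [ha']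
      · simp [hb']
      · change - F.d i (-c') = F.d i c'
        simp
    · rintro ⟨w, hw⟩
      obtain ⟨⟨a', b', c'⟩, rfl⟩ := (e3 K σ _ _ _).symm.surjective w
      rw [← hw]
      have h0 : DD i (DD (i + 1) (a', b', c')) = 0 := by
        rw [hDD, hDD]
        refine Prod.ext ?_ (Prod.ext ?_ ?_)
        · change F.d i (F.d (i + 1) a' + (X v : MvPolynomial σ K) • c') +
            (X v : MvPolynomial σ K) • (- F.d i c') = 0
          rw [map_add, hdd, sm, zero_add, smul_neg, add_neg_cancel]
        · change H.d i (H.d (i + 1) b' - f (i + 1) c') - f i (- F.d i c') = 0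
          rw [map_sub, hee, hf1, map_neg]; abel
        · change - pd F.d i (- F.d i c') = 0
          rw [map_neg, hpdd]; simp
      change (e3 K σ _ _ _).symm (DD i (e3 K σ _ _ _ ((e3 K σ _ _ _).symm
        (DD (i + 1) (e3 K σ _ _ _ ((e3 K σ _ _ _).symm (a', b', c'))))))) = 0
      rw [LinearEquiv.apply_symm_apply]
      erw [LinearEquiv.apply_symm_apply]
      rw [h0, map_zero]
  · rintro (b | b | b)
    · simp only [LinearMap.comp_apply, LinearEquiv.coe_coe, e3_inl, hep, map_zero, mul_zero,
        add_zero]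
      exact F.homog_ε b
    · rw [Hm_zero_iff]
      simp only [LinearMap.comp_apply, LinearEquiv.coe_coe, e3_inm, hep, map_zero, zero_add]
      have := (Hm_zero_iff _ _).1 (H.homog_ε b)
      exact (Hm.X v (H.deg 0 b)).mul this
    · exact b.elim
  · intro i b c
    rw [Hm_iff]
    rcases b with b | b | b
    · simp only [LinearMap.comp_apply, LinearEquiv.coe_coe, e3_inl, hDD]
      rcases c with c | c | c
      · simpa [e3s_inl] using R_grl F i b c
      · simpa [e3s_inm] using Hm.zero _ _
      · simpa [e3s_inr] using Hm.zero _ _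
    · simp only [LinearMap.comp_apply, LinearEquiv.coe_coe, e3_inm, hDD]
      rcases c with c | c | c
      · simpa [e3s_inl] using Hm.zero _ _
      · simpa [e3s_inm] using hsh _ _ _ (R_grl H i b c)
      · simpa [e3s_inr] using Hm.zero _ _
    · change F.ι i at b
      simp only [LinearMap.comp_apply, LinearEquiv.coe_coe]
      erw [e3_inr]
      rw [hDD]
      rcases c with c | c | c
      · simp only [e3s_inl, map_zero, zero_add, Finsupp.smul_apply, smul_eq_mul]
        exact (Hm.X v (F.deg i b)).mul (Hm_single _ _ _)
      · simp only [e3s_inm, map_zero, zero_sub, Finsupp.neg_apply]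
        exact (hsh _ _ _ (hf i b c)).neg
      · simp only [e3s_inr, Finsupp.neg_apply]
        exact (hpd i b c).neg
  · intro i b c
    rcases b with b | b | b
    · simp only [LinearMap.comp_apply, LinearEquiv.coe_coe, e3_inl, hDD]
      rcases c with c | c | c
      · simpa [e3s_inl] using F.minimal i b c
      · simp [e3s_inm]
      · simp [e3s_inr]
    · simp only [LinearMap.comp_apply, LinearEquiv.coe_coe, e3_inm, hDD]
      rcases c with c | c | c
      · simp [e3s_inl]
      · simpa [e3s_inm] using H.minimal i b c
      · simp [e3s_inr]
    · change F.ι i at b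
      simp only [LinearMap.comp_apply, LinearEquiv.coe_coe]
      erw [e3_inr]
      rw [hDD]
      rcases c with c | c | c
      · simp only [e3s_inl, map_zero, zero_add, Finsupp.smul_apply, smul_eq_mul, map_mul,
          constantCoeff_X, zero_mul]
      · simp [e3s_inm, fcc]
      · simp [e3s_inr, hpc]
  · intro i r
    simp [Sum.exists]

end cone

section final
variable {K σ : Type} [Field K]

/-- monomial ideal generated by the monomials with exponents in `M` -/
def monI (K : Type) {σ : Type} [Field K] (M : Set (σ →₀ ℕ)) : Ideal (MvPolynomial σ K) :=
  Ideal.span ((fun s => monomial s (1 : K)) '' M)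

theorem mem_monI {M : Set (σ →₀ ℕ)} {p : MvPolynomial σ K} :
    p ∈ monI K M ↔ ∀ m ∈ p.support, ∃ s ∈ M, s ≤ m := mem_ideal_span_monomial_image

theorem monI_nzd {M : Set (σ →₀ ℕ)} {v : σ} (hM : ∀ m ∈ M, m v = 0) (b : MvPolynomial σ K)
    (h : X v * b ∈ monI K M) : b ∈ monI K M := by
  classical
  rw [mem_monI] at h ⊢
  intro m hm
  obtain ⟨s, hs, hle⟩ := h (Finsupp.single v 1 + m) (by
    rw [mem_support_iff, coeff_X_mul]; exact mem_support_iff.1 hm)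
  refine ⟨s, hs, fun i => ?_⟩
  by_cases hi : i = v
  · subst hi; rw [hM s hs]; exact Nat.zero_le _
  · have := hle i
    rwa [Finsupp.add_apply, Finsupp.single_apply, if_neg (Ne.symm hi), zero_add] at this

theorem monI_pc {M : Set (σ →₀ ℕ)} (p : MvPolynomial σ K) (h : p ∈ monI K M) (e : ℕ) :
    pc 0 e p ∈ monI K M := by
  rw [mem_monI] at h ⊢
  intro m hm
  apply h
  rw [mem_support_iff, coeff_pc] at hm
  rw [mem_support_iff]
  intro h0; apply hm; simp [h0]

theorem span_X_eq (W : Set σ) : Ideal.span ((X : σ → MvPolynomial σ K) '' W) =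
    monI K ((fun i => Finsupp.single i 1) '' W) := by
  rw [monI, Set.image_image]; rfl

/-- index types of the trivial resolution -/
abbrev uI : ℕ → Type
  | 0 => Unit
  | _ + 1 => Empty

/-- the trivial resolution of the unit ideal -/
def topRes (K σ : Type) [Field K] : MinimalGradedFreeResolution (⊤ : Ideal (MvPolynomial σ K)) where
  ι := uI
  finite := by
    intro i
    cases i with
    | zero => exact inferInstanceAs (Finite Unit)
    | succ i => exact inferInstanceAs (Finite Empty)
  deg := fun _ _ => 0
  d := fun _ => 0
  ε := Finsupp.lapply ()
  range_ε := by
    rw [LinearMap.range_eq_top]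
    intro p
    exact ⟨Finsupp.single () p, by simp⟩
  exact_ε := by
    ext x
    constructor
    · intro h
      have : x = 0 := Finsupp.ext fun i => h
      rw [this]; exact Submodule.zero_mem _
    · rintro ⟨y, rfl⟩; simp
  exact_d := by
    intro i
    ext x
    have : x = 0 := Finsupp.ext fun i => i.elim
    subst this
    simp
  homog_ε := by
    intro b
    rw [Hm_zero_iff]
    simpa using Hm.one 0
  homog_d := by intro i b; exact b.elim
  minimal := by intro i b; exact b.elim

/-- the trivial resolution of the zero ideal -/
def botRes (K σ : Type) [Field K] : MinimalGradedFreeResolution (⊥ : Ideal (MvPolynomial σ K)) where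
  ι := fun _ => Empty
  finite := fun _ => inferInstance
  deg := fun _ _ => 0
  d := fun _ => 0
  ε := 0
  range_ε := LinearMap.range_zero
  exact_ε := by
    ext x
    have : x = 0 := Finsupp.ext fun i => i.elim
    subst this
    simp
  exact_d := by
    intro i
    ext x
    have : x = 0 := Finsupp.ext fun i => i.elim
    subst this
    simp
  homog_ε := by intro b; exact b.elim
  homog_d := by intro i b; exact b.elim
  minimal := by intro i b; exact b.elim

theorem exists_linear (W : Finset σ) :
    ∃ R : MinimalGradedFreeResolution
      (Ideal.span ((X : σ → MvPolynomial σ K) '' (W : Set σ))), ∀ i b, R.deg i b = i + 1 := by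
  classical
  induction W using Finset.induction_on with
  | empty =>
    rw [Finset.coe_empty, Set.image_empty, Ideal.span_empty]
    exact ⟨botRes K σ, fun i b => b.elim⟩
  | insert w W hw ih =>
    obtain ⟨F, hF⟩ := ih
    obtain ⟨R, hR⟩ := exists_cone
      (T := Ideal.span ((X : σ → MvPolynomial σ K) '' ((insert w W : Finset σ) : Set σ)))
      F (topRes K σ) le_top w (by
        rw [span_X_eq]
        apply monI_nzd
        rintro _ ⟨i, hi, rfl⟩
        have : i ≠ w := by rintro rfl; exact hw hi
        simp [this])
      (by
        intro p
        rw [Finset.coe_insert, Set.image_insert_eq, Ideal.mem_span_insert]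
        constructor
        · rintro ⟨a, z, hz, rfl⟩
          exact ⟨z, hz, a, trivial, by ring⟩
        · rintro ⟨z, hz, a, _, rfl⟩
          exact ⟨a, z, hz, by ring⟩)
      (by
        intro i b c
        rw [hF]
        change 0 ≠ _
        omega)
    refine ⟨R, fun i b => ?_⟩
    rcases (hR i (R.deg i b)).1 ⟨b, rfl⟩ with ⟨b', h⟩ | ⟨b', h⟩ | ⟨b', h⟩
    · rw [← h, hF]
    · cases i with
      | zero => rw [← h]; rfl
      | succ i => exact b'.elim
    · cases i with
      | zero => exact b'.elim
      | succ i =>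
        rw [← h]
        change F.deg i b' + 1 = _
        rw [hF]

theorem deg_ge {A : Ideal (MvPolynomial σ K)} (F : MinimalGradedFreeResolution A) (t : ℕ)
    (hA : ∀ p ∈ A, p ≠ 0 → ∀ e, Hm p 0 e → t ≤ e) : ∀ i (b : F.ι i), i + t ≤ F.deg i b := by
  intro i
  induction i with
  | zero =>
    intro b
    rw [zero_add]
    refine hA _ (R_mem F (Finsupp.single b 1)) ?_ _ ((Hm_zero_iff _ _).1 (F.homog_ε b))
    intro h
    obtain ⟨y, hy⟩ := F.exact_ε.le h
    have := R_cc F 0 y b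
    rw [hy] at this
    simp at this
  | succ i ih =>
    intro b
    have hne : F.d i (Finsupp.single b 1) ≠ 0 := by
      intro h
      obtain ⟨y, hy⟩ := (F.exact_d i).le h
      have := R_cc F (i + 1) y b
      rw [hy] at this
      simp at this
    obtain ⟨c, hc⟩ := Finsupp.ne_iff.1 hne
    obtain ⟨m, hm⟩ := exists_coeff_ne_zero hc
    have h1 := R_grl F i b c m hm
    have h2 : m ≠ 0 := by
      rintro rfl
      exact hm (F.minimal i b c)
    have h3 : m.degree ≠ 0 := fun h => h2 ((Finsupp.degree_eq_zero_iff m).1 h)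
    have := ih c
    omega

theorem exists_deg {A : Ideal (MvPolynomial σ K)} (F : MinimalGradedFreeResolution A) (t : ℕ)
    {p : MvPolynomial σ K} (hp : p ∈ A) (hp0 : p ≠ 0) (hh : Hm p 0 t) :
    ∃ b : F.ι 0, F.deg 0 b ≤ t := by
  classical
  obtain ⟨x, rfl⟩ := F.range_ε.ge hp
  have := F.finite 0
  have := Fintype.ofFinite (F.ι 0)
  by_contra! hc
  apply hp0
  rw [map_apply_eq'] at hh ⊢
  ext m
  by_contra hm
  have h1 := hh m hm
  rw [coeff_zero, coeff_sum] at hm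
  obtain ⟨b, _, hb⟩ := Finset.exists_ne_zero_of_sum_ne_zero hm
  rw [coeff_mul] at hb
  obtain ⟨⟨u, w⟩, huw, hne⟩ := Finset.exists_ne_zero_of_sum_ne_zero hb
  have h2 := (Hm_zero_iff _ _).1 (F.homog_ε b) w (right_ne_zero_of_mul hne)
  have h3 : u + w = m := by simpa using huw
  have h4 := hc b
  rw [← h3, map_add] at h1
  omega

end final

end
/-- removing a simplicial vertex `v` of `G` preserves the regularity of
the edge ideal of the complement (both ideals nonzero, in `S = K[x₁,…,xₙ]`). -/
theorem stmt17 (K : Type) [Field K] (n : ℕ) (G : SimpleGraph (Fin n)) (v : Fin n)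
    (hv : ∀ a b : Fin n, G.Adj v a → G.Adj v b → a ≠ b → G.Adj a b)
    (hI : edgeIdeal K Gᶜ ≠ ⊥)
    (hJ : Ideal.span {p : MvPolynomial (Fin n) K |
        ∃ i j : Fin n, i ≠ v ∧ j ≠ v ∧ i ≠ j ∧ ¬ G.Adj i j ∧ p = X i * X j} ≠ ⊥) :
    reg (edgeIdeal K Gᶜ) =
    reg (Ideal.span {p : MvPolynomial (Fin n) K |
        ∃ i j : Fin n, i ≠ v ∧ j ≠ v ∧ i ≠ j ∧ ¬ G.Adj i j ∧ p = X i * X j}) := by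
  classical
  set J := Ideal.span {p : MvPolynomial (Fin n) K |
        ∃ i j : Fin n, i ≠ v ∧ j ≠ v ∧ i ≠ j ∧ ¬ G.Adj i j ∧ p = X i * X j} with hJdef
  let M : Set (Fin n →₀ ℕ) := {m | ∃ i j : Fin n, i ≠ v ∧ j ≠ v ∧ i ≠ j ∧ ¬ G.Adj i j ∧
    m = Finsupp.single i 1 + Finsupp.single j 1}
  have hXX : ∀ i j : Fin n, (X i * X j : MvPolynomial (Fin n) K) =
      monomial (Finsupp.single i 1 + Finsupp.single j 1) 1 := by
    intro i j
    rw [X, X, monomial_mul, one_mul]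
  have hJM : J = monI K M := by
    rw [hJdef, monI]
    congr 1
    ext p
    constructor
    · rintro ⟨i, j, h1, h2, h3, h4, rfl⟩
      exact ⟨_, ⟨i, j, h1, h2, h3, h4, rfl⟩, (hXX i j).symm⟩
    · rintro ⟨_, ⟨i, j, h1, h2, h3, h4, rfl⟩, rfl⟩
      exact ⟨i, j, h1, h2, h3, h4, (hXX i j).symm⟩
  obtain ⟨F⟩ := exists_resolution J (by
    rw [hJM]; exact fun p hp e => monI_pc p hp e)
  have hF : ∀ i (b : F.ι i), i + 2 ≤ F.deg i b := by
    apply deg_ge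
    intro p hp hp0 e he
    rw [hJM, mem_monI] at hp
    obtain ⟨m, hm⟩ := exists_coeff_ne_zero hp0
    obtain ⟨_, ⟨i, j, -, -, -, -, rfl⟩, hle⟩ := hp m (mem_support_iff.2 hm)
    have h1 := he m hm
    have h2 := Finsupp.degree_mono hle
    rw [map_add, Finsupp.degree_single, Finsupp.degree_single] at h2
    omega
  have hF2 : ∃ b : F.ι 0, F.deg 0 b = 0 + 2 := by
    obtain ⟨i, j, h1, h2, h3, h4⟩ : ∃ i j : Fin n, i ≠ v ∧ j ≠ v ∧ i ≠ j ∧ ¬ G.Adj i j := by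
      by_contra! hcon
      apply hJ
      rw [hJdef, Ideal.span_eq_bot]
      rintro p ⟨i, j, h1, h2, h3, h4, _⟩
      exact absurd (hcon i j h1 h2 h3) h4
    obtain ⟨b, hb⟩ := exists_deg F 2 (p := X i * X j)
      (Ideal.subset_span ⟨i, j, h1, h2, h3, h4, rfl⟩)
      (mul_ne_zero (X_ne_zero i) (X_ne_zero j))
      ((Hm.X i 1).mul (Hm.X j 0))
    exact ⟨b, le_antisymm (by omega) (hF 0 b)⟩
  let W : Finset (Fin n) := Finset.univ.filter fun w => v ≠ w ∧ ¬ G.Adj v w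
  obtain ⟨H, hH⟩ := exists_linear (K := K) W
  have hJW : J ≤ Ideal.span ((X : Fin n → MvPolynomial (Fin n) K) '' (W : Set (Fin n))) := by
    rw [hJdef, Ideal.span_le]
    rintro p ⟨i, j, h1, h2, h3, h4, rfl⟩
    by_cases hi : G.Adj v i
    · have hj : ¬ G.Adj v j := fun hj => h4 (hv i j hi hj h3)
      exact Ideal.mul_mem_left _ _ (Ideal.subset_span ⟨j, by simp [W, hj, Ne.symm h2], rfl⟩)
    · exact Ideal.mul_mem_right _ _ (Ideal.subset_span ⟨i, by simp [W, hi, Ne.symm h1], rfl⟩)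
  obtain ⟨R, hR⟩ := exists_cone (T := edgeIdeal K Gᶜ) F H hJW v
    (by
      rw [hJM]
      apply monI_nzd
      rintro _ ⟨i, j, h1, h2, -, -, rfl⟩
      simp [h1, h2])
    (by
      have hT : edgeIdeal K Gᶜ = J ⊔ Ideal.span {X v} *
          Ideal.span ((X : Fin n → MvPolynomial (Fin n) K) '' (W : Set (Fin n))) := by
        apply le_antisymm
        · rw [edgeIdeal, Ideal.span_le]
          rintro p ⟨i, j, hij, rfl⟩
          rw [SimpleGraph.compl_adj] at hij
          by_cases hi : i = v
          · subst hi
            exact Ideal.mem_sup_right (Ideal.mul_mem_mul (Ideal.subset_span rfl)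
              (Ideal.subset_span ⟨j, by simp [W, hij], rfl⟩))
          · by_cases hj : j = v
            · subst hj
              rw [mul_comm (X i : MvPolynomial (Fin n) K) (X j)]
              exact Ideal.mem_sup_right (Ideal.mul_mem_mul (Ideal.subset_span rfl)
                (Ideal.subset_span ⟨i, by
                  simp [W, hij, Ne.symm hij.1, G.adj_comm j i], rfl⟩))
            · exact Ideal.mem_sup_left (Ideal.subset_span ⟨i, j, hi, hj, hij.1, hij.2, rfl⟩)
        · apply sup_le
          · rw [hJdef, Ideal.span_le]
            rintro p ⟨i, j, h1, h2, h3, h4, rfl⟩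
            exact Ideal.subset_span ⟨i, j, (SimpleGraph.compl_adj _ _ _).2 ⟨h3, h4⟩, rfl⟩
          · rw [Ideal.span_mul_span', Ideal.span_le]
            rintro _ ⟨_, rfl, _, ⟨w, hw, rfl⟩, rfl⟩
            refine Ideal.subset_span ⟨v, w, (SimpleGraph.compl_adj _ _ _).2 ?_, rfl⟩
            simpa [W] using hw
      intro p
      rw [hT, Submodule.mem_sup]
      constructor
      · rintro ⟨a, ha, z, hz, rfl⟩
        obtain ⟨b, hb, rfl⟩ := Ideal.mem_span_singleton_mul.1 hz
        exact ⟨a, ha, b, hb, rfl⟩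
      · rintro ⟨a, ha, b, hb, rfl⟩
        exact ⟨a, ha, _, Ideal.mem_span_singleton_mul.2 ⟨b, hb, rfl⟩, rfl⟩)
    (by
      intro i b c
      have := hF i b
      rw [hH]
      omega)
  rw [reg_eq R, reg_eq F]
  congr 1
  ext r
  constructor
  · rintro ⟨i, hb⟩
    rcases (hR i (i + r)).1 hb with h | ⟨b, h⟩ | ⟨b, h⟩
    · exact ⟨i, h⟩
    · rw [hH] at h
      have : r = 2 := by omega
      subst this
      exact ⟨0, hF2⟩
    · cases i with
      | zero => exact b.elim
      | succ i =>
        refine ⟨i, b, ?_⟩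
        change F.deg i b + 1 = _ at h
        omega
  · rintro ⟨i, hb⟩
    exact ⟨i, (hR i (i + r)).2 (Or.inl hb)⟩
end

section
/- Let G be a non-complete graph with a simplicial vertex v such that G \ v is complete. Then the Alexander dual of I = I(Ḡ) equals (x_v, ∏_{{v,i} ∈ E(Ḡ)} x_i); in particular S/I^∨ is Cohen–Macaulay and I has a 2-linear resolution. -/
open MvPolynomial

noncomputable section Aux18

open scoped Pointwise

variable {K : Type} [Field K] {σ : Type}

/-- The linear forms `x_i - c_i x_o`. -/
def linForm (K : Type) [Field K] {σ : Type} (c : σ → K) (o i : σ) : MvPolynomial σ K :=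
  X i - C (c i) * X o

/-- The ideal generated by the linear forms indexed by `T`. -/
def linIdeal (K : Type) [Field K] {σ : Type} (c : σ → K) (o : σ) (T : Set σ) :
    Ideal (MvPolynomial σ K) :=
  Ideal.span (linForm K c o '' T)

open Classical in
/-- The substitution killing the linear forms indexed by `T`. -/
def linSubst (K : Type) [Field K] {σ : Type} (c : σ → K) (o : σ) (T : Set σ) :
    MvPolynomial σ K →ₐ[K] MvPolynomial σ K :=
  aeval (fun i => if i ∈ T then C (c i) * X o else X i)

lemma linSubst_X_mem (c : σ → K) (o : σ) (T : Set σ) {i : σ} (hi : i ∈ T) :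
    linSubst K c o T (X i) = C (c i) * X o := by
  simp [linSubst, hi]

lemma linSubst_X_notMem (c : σ → K) (o : σ) (T : Set σ) {i : σ} (hi : i ∉ T) :
    linSubst K c o T (X i) = X i := by
  simp [linSubst, hi]

lemma sub_linSubst_mem (c : σ → K) (o : σ) (T : Set σ) (p : MvPolynomial σ K) :
    p - linSubst K c o T p ∈ linIdeal K c o T := by
  have h : (Ideal.Quotient.mkₐ K (linIdeal K c o T)) =
      (Ideal.Quotient.mkₐ K (linIdeal K c o T)).comp (linSubst K c o T) := by
    apply MvPolynomial.algHom_ext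
    intro i
    by_cases hi : i ∈ T
    · rw [AlgHom.comp_apply, linSubst_X_mem c o T hi]
      simp only [Ideal.Quotient.mkₐ_eq_mk]
      rw [Ideal.Quotient.eq]
      exact Ideal.subset_span ⟨i, hi, rfl⟩
    · rw [AlgHom.comp_apply, linSubst_X_notMem c o T hi]
  have h2 := DFunLike.congr_fun h p
  simp only [AlgHom.comp_apply, Ideal.Quotient.mkₐ_eq_mk] at h2
  rwa [Ideal.Quotient.eq] at h2

lemma linIdeal_eq_ker (c : σ → K) (o : σ) (T : Set σ) (ho : o ∉ T) :
    linIdeal K c o T = RingHom.ker (linSubst K c o T) := by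
  apply le_antisymm
  · rw [linIdeal, Ideal.span_le]
    rintro _ ⟨i, hi, rfl⟩
    simp [RingHom.mem_ker, linForm, linSubst_X_mem c o T hi, linSubst_X_notMem c o T ho,
      ← MvPolynomial.algebraMap_eq]
  · intro p hp
    have := sub_linSubst_mem c o T p
    rwa [RingHom.mem_ker.mp hp, sub_zero] at this

lemma linIdeal_isPrime (c : σ → K) (o : σ) (T : Set σ) (ho : o ∉ T) :
    (linIdeal K c o T).IsPrime := by
  rw [linIdeal_eq_ker c o T ho]
  exact RingHom.ker_isPrime _

lemma linForm_notMem (c : σ → K) (o : σ) (T : Set σ) (ho : o ∉ T) {i : σ} (hi : i ∉ T)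
    (hio : i ≠ o) : linForm K c o i ∉ linIdeal K c o T := by
  rw [linIdeal_eq_ker c o T ho, RingHom.mem_ker]
  intro h
  classical
  have h2 := congrArg (MvPolynomial.eval (fun j => if j = i then (1 : K) else 0)) h
  simp [linForm, linSubst_X_notMem c o T hi, linSubst_X_notMem c o T ho, hio.symm,
    ← MvPolynomial.algebraMap_eq] at h2

lemma linIdeal_insert (c : σ → K) (o : σ) (T : Set σ) (i : σ) :
    linIdeal K c o (insert i T) = linIdeal K c o T ⊔ Ideal.span {linForm K c o i} := by
  rw [linIdeal, linIdeal, Set.image_insert_eq, Ideal.span_insert, sup_comm]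

/-- Variables outside `T` are nonzerodivisors modulo the variables in `T`. -/
lemma X_mul_mem_span_X (T : Set σ) {j : σ} (hj : j ∉ T) (p : MvPolynomial σ K)
    (hp : X j * p ∈ Ideal.span ((X : σ → MvPolynomial σ K) '' T)) :
    p ∈ Ideal.span ((X : σ → MvPolynomial σ K) '' T) := by
  have e : linIdeal K (fun _ => 0) j T = Ideal.span ((X : σ → MvPolynomial σ K) '' T) := by
    have : linForm K (fun _ => 0) j = (X : σ → MvPolynomial σ K) := by
      funext i
      simp [linForm]
    rw [linIdeal, this]
  rw [← e] at hp ⊢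
  refine ((linIdeal_isPrime _ j T hj).mem_or_mem hp).resolve_left ?_
  rw [linIdeal_eq_ker _ j T hj, RingHom.mem_ker, linSubst_X_notMem _ j T hj]
  exact X_ne_zero j

/-- Quotienting one more element. -/
def quotSMulTopEquiv {R : Type} [CommRing R] (I : Ideal R) (r : R) :
    QuotSMulTop r (R ⧸ I) ≃ₗ[R] (R ⧸ (I ⊔ Ideal.span {r})) :=
  (Submodule.quotEquivOfEq (r • (⊤ : Submodule R (R ⧸ I)))
      (Submodule.map I.mkQ (Ideal.span {r} : Ideal R)) (by
        ext x
        obtain ⟨x, rfl⟩ := Submodule.mkQ_surjective _ x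
        rw [Submodule.mem_smul_pointwise_iff_exists, Submodule.mem_map]
        constructor
        · rintro ⟨y, -, hy⟩
          obtain ⟨y, rfl⟩ := Submodule.mkQ_surjective _ y
          refine ⟨r * y, Ideal.mul_mem_right _ _ (Ideal.mem_span_singleton_self r), ?_⟩
          rw [← hy, ← map_smul, smul_eq_mul]
        · rintro ⟨y, hy, hyx⟩
          obtain ⟨z, rfl⟩ := Ideal.mem_span_singleton'.mp hy
          refine ⟨I.mkQ z, trivial, ?_⟩
          rw [← hyx, ← map_smul, smul_eq_mul, mul_comm])) ≪≫ₗ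
    Submodule.quotientQuotientEquivQuotientSup I (Ideal.span {r})

lemma isRegular_cons_quot {R : Type} [CommRing R] (I : Ideal R) (r : R) (rs : List R)
    (h : ∀ x, r * x ∈ I → x ∈ I)
    (hrs : RingTheory.Sequence.IsRegular (R ⧸ (I ⊔ Ideal.span {r})) rs) :
    RingTheory.Sequence.IsRegular (R ⧸ I) (r :: rs) := by
  rw [RingTheory.Sequence.isRegular_cons_iff]
  refine ⟨?_, ((quotSMulTopEquiv I r).isRegular_congr rs).mpr hrs⟩
  rw [isSMulRegular_iff_right_eq_zero_of_smul]
  intro x hx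
  obtain ⟨x, rfl⟩ := Ideal.Quotient.mk_surjective x
  rw [Ideal.Quotient.eq_zero_iff_mem]
  apply h
  rw [← Ideal.Quotient.eq_zero_iff_mem, map_mul]
  rw [Algebra.smul_def] at hx
  exact hx

/-- The switching argument. -/
lemma switch_regular {R : Type} [CommRing R] (J : Ideal R) (hJ : J.IsPrime) (a f : R)
    (ha : a ∉ J) (hJa : (J ⊔ Ideal.span {a}).IsPrime) (hf : f ∉ J ⊔ Ideal.span {a})
    (x : R) (hx : a * x ∈ J ⊔ Ideal.span {f}) : x ∈ J ⊔ Ideal.span {f} := by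
  obtain ⟨j, hj, y, hy, hjy⟩ := Submodule.mem_sup.mp hx
  obtain ⟨d, rfl⟩ := Ideal.mem_span_singleton'.mp hy
  have hfd : f * d ∈ J ⊔ Ideal.span {a} := by
    have : f * d = a * x - j := by rw [← hjy]; ring
    rw [this]
    exact sub_mem (Ideal.mul_mem_right _ _ (Ideal.mem_sup_right
      (Ideal.mem_span_singleton_self a))) (Ideal.mem_sup_left hj)
  have hd := (hJa.mem_or_mem hfd).resolve_left hf
  obtain ⟨j', hj', z, hz, hjz⟩ := Submodule.mem_sup.mp hd
  obtain ⟨e, rfl⟩ := Ideal.mem_span_singleton'.mp hz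
  have h1 : a * (x - e * f) ∈ J := by
    have : a * (x - e * f) = j + j' * f := by
      have : a * x = j + (j' + e * a) * f := by rw [← hjy, ← hjz]
      rw [mul_sub, this]; ring
    rw [this]
    exact add_mem hj (Ideal.mul_mem_right _ _ hj')
  have h2 := (hJ.mem_or_mem h1).resolve_left ha
  have : x = (x - e * f) + e * f := by ring
  rw [this]
  exact add_mem (Ideal.mem_sup_left h2) (Ideal.mem_sup_right
    (Ideal.mul_mem_left _ _ (Ideal.mem_span_singleton_self f)))

lemma isRegular_linForms (c : σ → K) (o : σ) (f : MvPolynomial σ K)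
    (hf0 : constantCoeff f = 0)
    (hf : ∀ T : Set σ, o ∉ T → f ∉ linIdeal K c o T) (l : List σ) :
    ∀ T : Set σ, o ∉ T → o ∉ l → l.Nodup → (∀ i ∈ l, i ∉ T) →
      RingTheory.Sequence.IsRegular
        (MvPolynomial σ K ⧸ (linIdeal K c o T ⊔ Ideal.span {f})) (l.map (linForm K c o)) := by
  induction l with
  | nil =>
    intro T hT _ _ _
    have : Nontrivial (MvPolynomial σ K ⧸ (linIdeal K c o T ⊔ Ideal.span {f})) := by
      apply Ideal.Quotient.nontrivial_iff.mpr
      intro h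
      have hle : linIdeal K c o T ⊔ Ideal.span {f} ≤
          RingHom.ker (constantCoeff : MvPolynomial σ K →+* K) := by
        rw [sup_le_iff, linIdeal, Ideal.span_le, Ideal.span_singleton_le_iff_mem]
        refine ⟨?_, hf0⟩
        rintro _ ⟨i, _, rfl⟩
        simp [linForm, RingHom.mem_ker]
      rw [h, top_le_iff] at hle
      exact RingHom.ker_ne_top _ hle
    exact RingTheory.Sequence.IsRegular.nil _ _
  | cons i l ih =>
    intro T hT hol hnd hl
    simp only [List.mem_cons, not_or, List.nodup_cons, forall_eq_or_imp] at hol hnd hl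
    have hT' : o ∉ insert i T := by
      simp [hol.1, hT]
    rw [List.map_cons]
    apply isRegular_cons_quot
    · intro x hx
      refine switch_regular _ (linIdeal_isPrime c o T hT) _ f
        (linForm_notMem c o T hT hl.1 (Ne.symm hol.1)) ?_ ?_ x hx
      · rw [← linIdeal_insert]; exact linIdeal_isPrime c o _ hT'
      · rw [← linIdeal_insert]; exact hf _ hT'
    · have := ih (insert i T) hT' hol.2 hnd.2 (by
        intro j hj hjT
        rcases hjT with rfl | hjT
        · exact hnd.1 hj
        · exact hl.2 j hj hjT)
      rwa [linIdeal_insert, sup_right_comm] at this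

lemma length_le_supportDim {R : Type} [CommRing R] [IsNoetherianRing R] (rs : List R) :
    ∀ (M : Type) [AddCommGroup M] [Module R M] [Module.Finite R M],
    RingTheory.Sequence.IsRegular M rs → (rs.length : WithBot ℕ∞) ≤ Module.supportDim R M := by
  induction rs with
  | nil =>
    intro M _ _ _ h
    have : Nontrivial M := h.nontrivial
    have h2 := Module.supportDim_ne_bot_of_nontrivial R M
    obtain ⟨k, hk⟩ := WithBot.ne_bot_iff_exists.mp h2
    rw [← hk]
    simpa using WithBot.coe_le_coe.mpr (bot_le : ⊥ ≤ k)
  | cons r rs ih =>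
    intro M _ _ _ h
    rw [RingTheory.Sequence.isRegular_cons_iff] at h
    have h1 := ih (QuotSMulTop r M) h.2
    have h2 := Module.supportDim_quotSMulTop_succ_le_of_notMem_minimalPrimes (M := M) (x := r)
      (fun _ => h.1.notMem_of_mem_minimalPrimes)
    refine le_trans ?_ h2
    rw [List.length_cons]
    push_cast
    gcongr

lemma dim_sup_span_le {R : Type} [CommRing R] (J : Ideal R) (hJ : J.IsPrime) (f : R)
    (hf : f ∉ J) : ringKrullDim (R ⧸ (J ⊔ Ideal.span {f})) + 1 ≤ ringKrullDim (R ⧸ J) := by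
  refine ringKrullDim_succ_le_of_surjective (Ideal.Quotient.factor (S := J)
    (T := J ⊔ Ideal.span {f}) le_sup_left) (Ideal.Quotient.factor_surjective _)
    (r := Ideal.Quotient.mk J f) ?_ ?_
  · apply mem_nonZeroDivisors_of_ne_zero
    rwa [Ne, Ideal.Quotient.eq_zero_iff_mem]
  · rw [Ideal.Quotient.factor_mk, Ideal.Quotient.eq_zero_iff_mem]
    exact Ideal.mem_sup_right (Ideal.mem_span_singleton_self f)

lemma cancel_two (x : WithBot ℕ∞) (m : ℕ) (h : x + 1 + 1 ≤ (m : WithBot ℕ∞) + 1 + 1) :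
    x ≤ m := by
  induction x with
  | bot => exact bot_le
  | coe x =>
    induction x using ENat.recTopCoe with
    | top => 
      exfalso
      have h1 : (((⊤ : ℕ∞) + 1 + 1 : ℕ∞) : WithBot ℕ∞) ≤ (((m : ℕ∞) + 1 + 1 : ℕ∞) : WithBot ℕ∞) := h
      have h2 := WithBot.coe_le_coe.mp h1
      rw [top_add, top_add, top_le_iff] at h2
      exact ENat.natCast_ne_top (m + 1 + 1) (by exact_mod_cast h2)
    | coe k =>
      have h' : k + 1 + 1 ≤ m + 1 + 1 := by exact_mod_cast h
      have : k ≤ m := by omega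
      exact_mod_cast this

lemma dim_eq_depth (n : ℕ) (v o : Fin n) (A : Finset (Fin n)) (hvA : v ∉ A) (hoA : o ∈ A) :
    ringKrullDim (MvPolynomial (Fin n) K ⧸
        Ideal.span {(X v : MvPolynomial (Fin n) K), ∏ i ∈ A, X i}) =
      ((depthIdeal (irrelevantIdeal K (Fin n)) (MvPolynomial (Fin n) K ⧸
        Ideal.span {(X v : MvPolynomial (Fin n) K), ∏ i ∈ A, X i}) : ℕ) :
          WithBot (WithTop ℕ)) := by
  classical
  have hvo : o ≠ v := fun h => hvA (h ▸ hoA)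
  set f : MvPolynomial (Fin n) K := ∏ i ∈ A, X i with hfdef
  let c : Fin n → K := fun i => if i ∈ A then 1 else 0
  have hJ : Ideal.span {(X v : MvPolynomial (Fin n) K), f} =
      linIdeal K c o {v} ⊔ Ideal.span {f} := by
    rw [Ideal.span_insert, linIdeal, Set.image_singleton, linForm]
    simp [c, hvA]
  have hov : o ∉ ({v} : Set (Fin n)) := hvo
  have hf : ∀ T : Set (Fin n), o ∉ T → f ∉ linIdeal K c o T := by
    intro T hT
    rw [linIdeal_eq_ker c o T hT, RingHom.mem_ker, hfdef, map_prod, Finset.prod_eq_zero_iff]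
    rintro ⟨i, hi, h⟩
    by_cases hiT : i ∈ T
    · rw [linSubst_X_mem c o T hiT] at h
      simp [c, hi] at h
    · rw [linSubst_X_notMem c o T hiT] at h
      exact X_ne_zero i h
  have hf0 : constantCoeff f = 0 := by
    rw [hfdef, map_prod]
    exact Finset.prod_eq_zero hoA (by simp)
  rw [hJ]
  set Q := MvPolynomial (Fin n) K ⧸ (linIdeal K c o {v} ⊔ Ideal.span {f})
  let l : List (Fin n) := ((Finset.univ.erase v).erase o).toList
  have hlen : l.length + 2 = n := by
    have h1 : l.length = n - 1 - 1 := by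
      simp [l, Finset.card_erase_of_mem, hvo]
    have h2 : 1 < n := by
      have := v.2; have := o.2
      by_contra h
      exact hvo (Fin.ext (by omega))
    omega
  have hreg : RingTheory.Sequence.IsRegular Q (l.map (linForm K c o)) := by
    apply isRegular_linForms c o f hf0 hf l {v} hov
    · simp [l]
    · exact Finset.nodup_toList _
    · intro i hi
      simp [l] at hi
      exact hi.2
  have hsupp : Module.supportDim (MvPolynomial (Fin n) K) Q = ringKrullDim Q :=
    Module.supportDim_quotient_eq_ringKrullDim _
  have hge : ((l.length : ℕ) : WithBot ℕ∞) ≤ ringKrullDim Q := by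
    have := length_le_supportDim _ Q hreg
    rwa [hsupp, List.length_map] at this
  have hle : ringKrullDim Q ≤ ((l.length : ℕ) : WithBot ℕ∞) := by
    have h1 : ringKrullDim Q + 1 ≤ _ := dim_sup_span_le (linIdeal K c o {v}) (linIdeal_isPrime c o {v} hov) f
      (hf _ hov)
    have h2 := ringKrullDim_succ_le_of_surjective
      (Ideal.Quotient.mk (linIdeal K c o {v})) Ideal.Quotient.mk_surjective
      (r := linForm K c o v) (mem_nonZeroDivisors_of_ne_zero (by
        intro h
        apply linForm_notMem c o ∅ (by simp) (i := v) (by simp) (Ne.symm hvo)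
        rw [h]; exact zero_mem _))
      (by rw [Ideal.Quotient.eq_zero_iff_mem]; exact Ideal.subset_span ⟨v, rfl, rfl⟩)
    rw [MvPolynomial.ringKrullDim_of_isNoetherianRing, ringKrullDim_eq_zero_of_field, zero_add,
      Nat.card_eq_fintype_card, Fintype.card_fin] at h2
    have h3 : ringKrullDim Q + 1 + 1 ≤ (n : WithBot ℕ∞) := le_trans (by gcongr) h2
    have h4 : ((n : ℕ) : WithBot ℕ∞) = ((l.length : ℕ) : WithBot ℕ∞) + 1 + 1 := by
      have : n = l.length + 1 + 1 := by omega
      exact_mod_cast congrArg (fun m : ℕ => (m : WithBot ℕ∞)) this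
    rw [h4] at h3
    exact cancel_two _ _ h3
  have hdim := le_antisymm hle hge
  have hdepth : depthIdeal (irrelevantIdeal K (Fin n)) Q = l.length := by
    apply IsGreatest.csSup_eq
    constructor
    · refine ⟨l.map (linForm K c o), by simp, ?_, hreg⟩
      intro r hr
      obtain ⟨i, _, rfl⟩ := List.mem_map.mp hr
      exact sub_mem (Ideal.subset_span ⟨i, rfl⟩)
        (Ideal.mul_mem_left _ _ (Ideal.subset_span ⟨o, rfl⟩))
    · rintro k ⟨rs, rfl, _, hrs⟩
      have := length_le_supportDim _ Q hrs
      rw [hsupp, hdim] at this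
      exact_mod_cast this
  rw [hdepth, hdim]
  rfl

lemma edgeIdeal_compl_eq (n : ℕ) (G : SimpleGraph (Fin n)) (v : Fin n)
    (hcomp : ∀ i j : Fin n, i ≠ v → j ≠ v → i ≠ j → G.Adj i j) (A : Finset (Fin n))
    (hA : ∀ i, i ∈ A ↔ i ≠ v ∧ ¬ G.Adj v i) :
    edgeIdeal K Gᶜ = Ideal.span ((fun i => (X v * X i : MvPolynomial (Fin n) K)) '' A) := by
  rw [edgeIdeal]
  congr 1
  ext p
  constructor
  · rintro ⟨i, j, hij, rfl⟩
    rw [SimpleGraph.compl_adj] at hij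
    by_cases hi : i = v
    · subst hi
      exact ⟨j, by simpa [hA] using ⟨hij.1.symm, hij.2⟩, rfl⟩
    · by_cases hj : j = v
      · subst hj
        exact ⟨i, by simpa [hA] using ⟨hij.1, fun h => hij.2 h.symm⟩, mul_comm _ _⟩
      · exact absurd (hcomp i j hi hj hij.1) hij.2
  · rintro ⟨i, hi, rfl⟩
    have := (hA i).mp hi
    exact ⟨v, i, by simpa using ⟨this.1.symm, this.2⟩, rfl⟩

lemma alexDual_eq {σ : Type} [DecidableEq σ] (v : σ) (A : Finset σ) (hvA : v ∉ A) :
    alexDual (Ideal.span ((fun i => (X v * X i : MvPolynomial σ K)) '' A)) =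
      Ideal.span {(X v : MvPolynomial σ K), ∏ i ∈ A, X i} := by
  apply le_antisymm
  · intro p hp
    rw [alexDual] at hp
    simp only [Ideal.mem_iInf] at hp
    have h1 : ∀ i ∈ A, (X i : MvPolynomial σ K) ∣ linSubst K (fun _ => 0) v {v} p := by
      intro i hi
      have hiv : i ≠ v := fun h => hvA (h ▸ hi)
      have := hp {v, i} (by
        rw [Finset.prod_pair hiv.symm]
        exact Ideal.subset_span ⟨i, hi, rfl⟩)
      have h2 := Ideal.mem_map_of_mem (linSubst K (fun _ => 0) v {v}) this
      rw [Ideal.map_span, Finset.coe_pair, Set.image_pair, Set.image_pair,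
        linSubst_X_mem _ _ _ (Set.mem_singleton v), linSubst_X_notMem _ _ _ (by simpa using hiv)]
        at h2
      simpa [Ideal.span_insert_zero, Ideal.mem_span_singleton] using h2
    have h2 : (∏ i ∈ A, X i : MvPolynomial σ K) ∣ linSubst K (fun _ => 0) v {v} p := by
      apply Finset.prod_dvd_of_isRelPrime _ h1
      intro i hi j hj hij
      refine ((X_prime (R := K) (i := i)).irreducible.isRelPrime_iff_not_dvd).mpr ?_
      rw [X_dvd_X]
      exact hij
    have h3 := sub_linSubst_mem (K := K) (fun _ => 0) v {v} p
    have h4 : linIdeal K (fun _ => 0) v {v} ≤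
        Ideal.span {(X v : MvPolynomial σ K), ∏ i ∈ A, X i} := by
      rw [linIdeal, Set.image_singleton, Ideal.span_singleton_le_iff_mem, linForm]
      simp only [map_zero, zero_mul, sub_zero]
      exact Ideal.subset_span (by simp)
    have h5 : linSubst K (fun _ => 0) v {v} p ∈
        Ideal.span {(X v : MvPolynomial σ K), ∏ i ∈ A, X i} :=
      Ideal.mem_of_dvd _ h2 (Ideal.subset_span (by simp))
    have := add_mem (h4 h3) h5
    rwa [sub_add_cancel] at this
  · rw [alexDual]
    refine le_iInf fun s => le_iInf fun hs => ?_
    have key : v ∈ s ∧ ∃ i ∈ A, i ∈ s := by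
      by_contra hcon
      have hle : Ideal.span ((fun i => (X v * X i : MvPolynomial σ K)) '' A) ≤
          RingHom.ker (MvPolynomial.eval (fun j => if j ∈ s then (1 : K) else 0)) := by
        rw [Ideal.span_le]
        rintro _ ⟨i, hi, rfl⟩
        by_cases hv : v ∈ s
        · have : i ∉ s := fun h => hcon ⟨hv, i, hi, h⟩
          simp [RingHom.mem_ker, this]
        · simp [RingHom.mem_ker, hv]
      have := hle hs
      rw [RingHom.mem_ker, map_prod, Finset.prod_eq_zero_iff] at this
      obtain ⟨a, ha, h⟩ := this
      simp [ha] at h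
    obtain ⟨hv, i, hi, his⟩ := key
    rw [Ideal.span_le]
    rintro _ (rfl | rfl)
    · exact Ideal.subset_span ⟨v, hv, rfl⟩
    · exact Ideal.mem_of_dvd _ (Finset.dvd_prod_of_mem _ hi) (Ideal.subset_span ⟨i, his, rfl⟩)

end Aux18

noncomputable section Koszul18

variable {K : Type} [Field K] {σ : Type}

/-- A linear free resolution of the cyclic module `S/I`. -/
structure LinRes (I : Ideal (MvPolynomial σ K)) where
  ι : ℕ → Type
  finite : ∀ i, Finite (ι i)
  o : ι 0
  ho : ∀ b : ι 0, b = o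
  d : ∀ i, (ι (i + 1) →₀ MvPolynomial σ K) →ₗ[MvPolynomial σ K] (ι i →₀ MvPolynomial σ K)
  range_d0 : ∀ x : ι 0 →₀ MvPolynomial σ K, x ∈ LinearMap.range (d 0) ↔ x o ∈ I
  exact_d : ∀ i, LinearMap.ker (d i) = LinearMap.range (d (i + 1))
  homog : ∀ i, ∀ b : ι (i + 1), ∀ c : ι i, (d i (Finsupp.single b 1) c).IsHomogeneous 1

/-- The index types of the mapping cone. -/
def coneIdx (ι : ℕ → Type) : ℕ → Type
  | 0 => ι 0
  | i + 1 => ι (i + 1) ⊕ ι i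

/-- Splitting the cone in positive degree. -/
def coneEquiv (R : Type) [CommRing R] (ι : ℕ → Type) (i : ℕ) :
    (coneIdx ι (i + 1) →₀ R) ≃ₗ[R] (ι (i + 1) →₀ R) × (ι i →₀ R) :=
  Finsupp.sumFinsuppLEquivProdFinsupp R

/-- The differential of the mapping cone of multiplication by `y`. -/
def coneD {R : Type} [CommRing R] (y : R) (ι : ℕ → Type)
    (d : ∀ i, (ι (i + 1) →₀ R) →ₗ[R] (ι i →₀ R)) :
    ∀ i, (coneIdx ι (i + 1) →₀ R) →ₗ[R] (coneIdx ι i →₀ R)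
  | 0 => (((d 0).comp (LinearMap.fst R _ _) + y • LinearMap.snd R _ _ :
      ((ι 1 →₀ R) × (ι 0 →₀ R)) →ₗ[R] (ι 0 →₀ R))).comp (coneEquiv R ι 0).toLinearMap
  | i + 1 => (coneEquiv R ι i).symm.toLinearMap.comp
      ((((d (i + 1)).comp (LinearMap.fst R _ _) + y • LinearMap.snd R _ _ :
        ((ι (i + 2) →₀ R) × (ι (i + 1) →₀ R)) →ₗ[R] (ι (i + 1) →₀ R)).prod
        (-(d i).comp (LinearMap.snd R _ _))).comp (coneEquiv R ι (i + 1)).toLinearMap)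

lemma coneD_zero {R : Type} [CommRing R] (y : R) (ι : ℕ → Type)
    (d : ∀ i, (ι (i + 1) →₀ R) →ₗ[R] (ι i →₀ R)) (x : coneIdx ι 1 →₀ R) :
    (coneD y ι d 0 x : ι 0 →₀ R) =
      d 0 (coneEquiv R ι 0 x).1 + y • (coneEquiv R ι 0 x).2 := rfl

lemma coneD_succ {R : Type} [CommRing R] (y : R) (ι : ℕ → Type)
    (d : ∀ i, (ι (i + 1) →₀ R) →ₗ[R] (ι i →₀ R)) (i : ℕ) (x : coneIdx ι (i + 2) →₀ R) :
    coneEquiv R ι i (coneD y ι d (i + 1) x) =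
      (d (i + 1) (coneEquiv R ι (i + 1) x).1 + y • (coneEquiv R ι (i + 1) x).2,
        - d i (coneEquiv R ι (i + 1) x).2) := by
  simp [coneD]

lemma coneEquiv_inl (R : Type) [CommRing R] (ι : ℕ → Type) (i : ℕ) (b : ι (i + 1)) :
    coneEquiv R ι i (Finsupp.single (Sum.inl b : ι (i + 1) ⊕ ι i) 1) =
      (Finsupp.single b 1, 0) := by
  classical
  refine Prod.ext ?_ ?_
  · ext c
    change (Finsupp.single (Sum.inl b : ι (i + 1) ⊕ ι i) (1 : R)) (Sum.inl c) = _
    simp [Finsupp.single_apply]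
  · ext c
    change (Finsupp.single (Sum.inl b : ι (i + 1) ⊕ ι i) (1 : R)) (Sum.inr c) = _
    simp [Finsupp.single_apply]

lemma coneEquiv_inr (R : Type) [CommRing R] (ι : ℕ → Type) (i : ℕ) (b : ι i) :
    coneEquiv R ι i (Finsupp.single (Sum.inr b : ι (i + 1) ⊕ ι i) 1) =
      (0, Finsupp.single b 1) := by
  classical
  refine Prod.ext ?_ ?_
  · ext c
    change (Finsupp.single (Sum.inr b : ι (i + 1) ⊕ ι i) (1 : R)) (Sum.inl c) = _
    simp [Finsupp.single_apply]
  · ext c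
    change (Finsupp.single (Sum.inr b : ι (i + 1) ⊕ ι i) (1 : R)) (Sum.inr c) = _
    simp [Finsupp.single_apply]

lemma coneEquiv_fst (R : Type) [CommRing R] (ι : ℕ → Type) (i : ℕ) (x : coneIdx ι (i + 1) →₀ R)
    (c : ι (i + 1)) : (x : (ι (i + 1) ⊕ ι i) →₀ R) (Sum.inl c) = (coneEquiv R ι i x).1 c := rfl

lemma coneEquiv_snd (R : Type) [CommRing R] (ι : ℕ → Type) (i : ℕ) (x : coneIdx ι (i + 1) →₀ R)
    (c : ι i) : (x : (ι (i + 1) ⊕ ι i) →₀ R) (Sum.inr c) = (coneEquiv R ι i x).2 c := rfl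

lemma cone_exact {R M₁ M₂ M₃ : Type} [CommRing R] [AddCommGroup M₁] [AddCommGroup M₂]
    [AddCommGroup M₃] [Module R M₁] [Module R M₂] [Module R M₃] (y : R)
    (f₁ : M₂ →ₗ[R] M₁) (f₂ : M₃ →ₗ[R] M₂) (h : LinearMap.ker f₁ = LinearMap.range f₂)
    (a : M₂) (b : M₁) (hab : f₁ a + y • b = 0) (hb : b ∈ LinearMap.range f₁) :
    ∃ (e : M₃) (c : M₂), f₂ e + y • c = a ∧ - f₁ c = b := by
  obtain ⟨c, rfl⟩ := hb
  have : a + y • c ∈ LinearMap.ker f₁ := by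
    rw [LinearMap.mem_ker, map_add, map_smul, hab]
  rw [h] at this
  obtain ⟨e, he⟩ := this
  exact ⟨e, -c, by rw [he]; simp, by simp⟩

lemma isHomogeneous_single_one {τ : Type} (b c : τ) :
    ((Finsupp.single b (1 : MvPolynomial σ K)) c).IsHomogeneous 0 := by
  classical
  rw [Finsupp.single_apply]
  split_ifs
  · exact isHomogeneous_one _ _
  · exact isHomogeneous_zero _ _ _

/-- The mapping cone. -/
def LinRes.cone {I : Ideal (MvPolynomial σ K)} (F : LinRes I) (y : MvPolynomial σ K)
    (hy : y.IsHomogeneous 1) (hyI : ∀ p, y * p ∈ I → p ∈ I) : LinRes (I ⊔ Ideal.span {y}) where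
  ι := coneIdx F.ι
  finite i := by
    have := F.finite
    cases i with
    | zero => exact F.finite 0
    | succ i => exact inferInstanceAs (Finite (F.ι (i + 1) ⊕ F.ι i))
  o := F.o
  ho := F.ho
  d := coneD y F.ι F.d
  range_d0 := by
    intro x
    change F.ι 0 →₀ MvPolynomial σ K at x
    constructor
    · rintro ⟨z, rfl⟩
      change F.d 0 (coneEquiv _ F.ι 0 z).1 F.o + y * (coneEquiv _ F.ι 0 z).2 F.o ∈ _
      refine add_mem (Ideal.mem_sup_left ((F.range_d0 _).mp ⟨_, rfl⟩)) (Ideal.mem_sup_right ?_)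
      exact Ideal.mul_mem_right _ _ (Ideal.mem_span_singleton_self y)
    · intro hx
      obtain ⟨p, hp, q, hq, hpq⟩ := Submodule.mem_sup.mp hx
      obtain ⟨r, rfl⟩ := Ideal.mem_span_singleton'.mp hq
      obtain ⟨a, ha⟩ := (F.range_d0 (Finsupp.single F.o p)).mpr (by simpa using hp)
      refine ⟨(coneEquiv _ F.ι 0).symm (a, Finsupp.single F.o r), ?_⟩
      refine (coneD_zero y F.ι F.d _).trans ?_
      rw [LinearEquiv.apply_symm_apply, ha]
      ext b : 1
      rw [F.ho b]
      simp only [Finsupp.add_apply, Finsupp.smul_apply, Finsupp.single_eq_same, smul_eq_mul]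
      rw [mul_comm y r]
      exact hpq
  exact_d := by
    intro i
    have hdd : ∀ j c, F.d j (F.d (j + 1) c) = 0 := fun j c => by
      rw [← LinearMap.mem_ker, F.exact_d]; exact ⟨c, rfl⟩
    cases i with
    | zero =>
      ext x
      rw [LinearMap.mem_ker]
      constructor
      · intro hx
        have hx' := (coneD_zero y F.ι F.d x).symm.trans hx
        obtain ⟨e, c, h1, h2⟩ := cone_exact y (F.d 0) (F.d 1) (F.exact_d 0) _ _ hx' (by
          rw [F.range_d0]
          apply hyI
          have h3 : y • (coneEquiv _ F.ι 0 x).2 ∈ LinearMap.range (F.d 0) :=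
            ⟨-(coneEquiv _ F.ι 0 x).1, by rw [map_neg]; exact neg_eq_of_add_eq_zero_right hx'⟩
          exact (F.range_d0 _).mp h3)
        refine ⟨(coneEquiv _ F.ι 1).symm (e, c), ?_⟩
        apply (coneEquiv _ F.ι 0).injective
        rw [coneD_succ, LinearEquiv.apply_symm_apply]
        exact Prod.ext h1 h2
      · rintro ⟨z, rfl⟩
        refine (coneD_zero y F.ι F.d _).trans ?_
        rw [coneD_succ]
        simp only [map_add, map_smul, hdd, smul_neg, zero_add, add_neg_cancel]
        rfl
    | succ i =>
      ext x
      rw [LinearMap.mem_ker]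
      constructor
      · intro hx
        have hx' := (coneD_succ y F.ι F.d i x).symm.trans (congrArg _ hx)
        rw [map_zero, Prod.mk_eq_zero, neg_eq_zero] at hx'
        obtain ⟨e, c, h1, h2⟩ := cone_exact y (F.d (i + 1)) (F.d (i + 2)) (F.exact_d _) _ _ hx'.1
          (by rw [← F.exact_d]; exact hx'.2)
        refine ⟨(coneEquiv _ F.ι (i + 2)).symm (e, c), ?_⟩
        apply (coneEquiv _ F.ι (i + 1)).injective
        rw [coneD_succ, LinearEquiv.apply_symm_apply]
        exact Prod.ext h1 h2
      · rintro ⟨z, rfl⟩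
        apply (coneEquiv _ F.ι i).injective
        rw [coneD_succ, coneD_succ]
        simp [hdd]
  homog := by
    intro i b c
    have hneg : ∀ p : MvPolynomial σ K, p.IsHomogeneous 1 → (-p).IsHomogeneous 1 :=
      fun p hp => hp.neg
    have hys : ∀ {τ : Type} (b c : τ),
        (y • (Finsupp.single b (1 : MvPolynomial σ K))) c |>.IsHomogeneous 1 := by
      intro τ b c
      exact hy.mul (isHomogeneous_single_one b c)
    cases i with
    | zero =>
      change F.ι 0 at c
      rcases b with b | b
      · change (F.d 0 (coneEquiv _ F.ι 0 (Finsupp.single (Sum.inl b : F.ι 1 ⊕ F.ι 0) 1)).1 c +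
          y * (coneEquiv _ F.ι 0 (Finsupp.single (Sum.inl b : F.ι 1 ⊕ F.ι 0) 1)).2 c).IsHomogeneous 1
        rw [coneEquiv_inl]
        simpa using F.homog 0 b c
      · change (F.d 0 (coneEquiv _ F.ι 0 (Finsupp.single (Sum.inr b : F.ι 1 ⊕ F.ι 0) 1)).1 c +
          y * (coneEquiv _ F.ι 0 (Finsupp.single (Sum.inr b : F.ι 1 ⊕ F.ι 0) 1)).2 c).IsHomogeneous 1
        rw [coneEquiv_inr]
        have := hys b c
        rw [Finsupp.smul_apply, smul_eq_mul] at this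
        simpa using this
    | succ i =>
      rcases c with c | c
      · refine (congrArg (fun p : MvPolynomial σ K => p.IsHomogeneous 1)
          (coneEquiv_fst _ F.ι i _ c)).mpr ?_
        rw [coneD_succ]
        rcases b with b | b
        · rw [coneEquiv_inl]
          simpa using F.homog (i + 1) b c
        · rw [coneEquiv_inr]
          simpa using hys b c
      · refine (congrArg (fun p : MvPolynomial σ K => p.IsHomogeneous 1)
          (coneEquiv_snd _ F.ι i _ c)).mpr ?_
        rw [coneD_succ]
        rcases b with b | b
        · rw [coneEquiv_inl]
          simpa using isHomogeneous_zero _ _ _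
        · rw [coneEquiv_inr]
          simpa using hneg _ (F.homog i b c)

/-- Index types of the trivial resolution. -/
def trivIdx : ℕ → Type
  | 0 => Unit
  | _ + 1 => Empty

/-- The resolution of `S/0`. -/
def LinRes.triv (K : Type) [Field K] (σ : Type) : LinRes (⊥ : Ideal (MvPolynomial σ K)) where
  ι := trivIdx
  finite i := by
    cases i with
    | zero => exact inferInstanceAs (Finite Unit)
    | succ i => exact inferInstanceAs (Finite Empty)
  o := ()
  ho := fun _ => rfl
  d := fun _ => 0
  range_d0 := by
    intro x
    rw [LinearMap.range_zero, Submodule.mem_bot, Submodule.mem_bot]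
    constructor
    · rintro rfl; rfl
    · intro h
      ext b : 1
      exact h
  exact_d := by
    intro i
    have : Subsingleton (trivIdx (i + 1) →₀ MvPolynomial σ K) :=
      inferInstanceAs (Subsingleton (Empty →₀ MvPolynomial σ K))
    exact Subsingleton.elim _ _
  homog := by
    intro i b
    exact Empty.elim b

lemma exists_linRes (A : Finset σ) :
    Nonempty (LinRes (Ideal.span ((X : σ → MvPolynomial σ K) '' A))) := by
  classical
  induction A using Finset.induction_on with
  | empty =>
    have : Ideal.span ((X : σ → MvPolynomial σ K) '' (∅ : Finset σ)) = ⊥ := by simp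
    rw [this]
    exact ⟨LinRes.triv K σ⟩
  | insert j A hj ih =>
    obtain ⟨F⟩ := ih
    have : Ideal.span ((X : σ → MvPolynomial σ K) '' (insert j A : Finset σ)) =
        Ideal.span ((X : σ → MvPolynomial σ K) '' A) ⊔ Ideal.span {X j} := by
      rw [Finset.coe_insert, Set.image_insert_eq, Ideal.span_insert, sup_comm]
    rw [this]
    exact ⟨F.cone (X j) (isHomogeneous_X _ _)
      (fun p hp => X_mul_mem_span_X (A : Set σ) (by simpa using hj) p hp)⟩

lemma hasLinearResolution_aux (v : σ) (A : Finset σ) :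
    HasLinearResolution (Ideal.span ((fun i => (X v * X i : MvPolynomial σ K)) '' A)) 2 := by
  obtain ⟨F⟩ := exists_linRes (K := K) A
  have hX0 : (X v : MvPolynomial σ K) ≠ 0 := X_ne_zero v
  refine ⟨{
    ι := fun i => F.ι (i + 1)
    finite := fun i => F.finite (i + 1)
    deg := fun i _ => i + 2
    d := fun i => F.d (i + 1)
    ε := (X v : MvPolynomial σ K) • ((Finsupp.lapply F.o).comp (F.d 0))
    range_ε := ?_
    exact_ε := ?_
    exact_d := fun i => F.exact_d (i + 1)
    homog_ε := ?_
    homog_d := ?_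
    minimal := ?_ }, ?_⟩
  · ext p
    have hmem : p ∈ Ideal.span ((fun i => (X v * X i : MvPolynomial σ K)) '' A) ↔
        ∃ q ∈ Ideal.span ((X : σ → MvPolynomial σ K) '' A), X v * q = p := by
      have himg : ((fun i => (X v * X i : MvPolynomial σ K)) '' A) =
          (LinearMap.mulLeft (MvPolynomial σ K) (X v : MvPolynomial σ K)) ''
            ((X : σ → MvPolynomial σ K) '' A) := by
        rw [Set.image_image]; rfl
      rw [himg, Ideal.span, ← Submodule.map_span, Submodule.mem_map]
      rfl
    rw [hmem]
    constructor
    · rintro ⟨z, rfl⟩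
      exact ⟨_, (F.range_d0 _).mp ⟨z, rfl⟩, rfl⟩
    · rintro ⟨q, hq, rfl⟩
      obtain ⟨a, ha⟩ := (F.range_d0 (Finsupp.single F.o q)).mpr (by simpa using hq)
      exact ⟨a, by simp [ha]⟩
  · rw [← F.exact_d 0]
    ext x
    rw [LinearMap.mem_ker, LinearMap.mem_ker]
    simp only [LinearMap.smul_apply, LinearMap.comp_apply, Finsupp.lapply_apply, smul_eq_mul,
      mul_eq_zero, hX0, false_or]
    constructor
    · intro h
      ext b : 1
      rw [F.ho b, h]; rfl
    · intro h
      rw [h]; rfl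
  · intro b
    exact (isHomogeneous_X K v).mul (F.homog 0 b F.o)
  · intro i b c
    right
    refine ⟨by omega, ?_⟩
    have : i + 1 + 2 - (i + 2) = 1 := by omega
    rw [this]
    exact F.homog (i + 1) b c
  · intro i b c
    exact (F.homog (i + 1) b c).coeff_eq_zero (by simp)
  · intro i j h
    by_contra hj
    apply h
    have : IsEmpty {b : F.ι (i + 1) // i + 2 = j} := ⟨fun b => hj b.2.symm⟩
    exact Nat.card_of_isEmpty

end Koszul18

open Classical in
/-- if `G` is non-complete with a simplicial vertex `v` such that
`G \ v` is complete, then `I(Ḡ)^∨ = (x_v, ∏_{{v,i} ∈ E(Ḡ)} x_i)`; in particular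
`S/I^∨` is Cohen–Macaulay and `I(Ḡ)` has a 2-linear resolution. -/
theorem stmt18 (K : Type) [Field K] (n : ℕ) (G : SimpleGraph (Fin n)) (v : Fin n)
    (hnc : ∃ i j : Fin n, i ≠ j ∧ ¬ G.Adj i j)
    (hv : ∀ a b : Fin n, G.Adj v a → G.Adj v b → a ≠ b → G.Adj a b)
    (hcomp : ∀ i j : Fin n, i ≠ v → j ≠ v → i ≠ j → G.Adj i j) :
    alexDual (edgeIdeal K Gᶜ) =
      Ideal.span {(X v : MvPolynomial (Fin n) K),
        ∏ i ∈ Finset.univ.filter (fun i : Fin n => i ≠ v ∧ ¬ G.Adj v i), X i} ∧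
    ringKrullDim (MvPolynomial (Fin n) K ⧸ alexDual (edgeIdeal K Gᶜ)) =
      ((depthIdeal (irrelevantIdeal K (Fin n))
        (MvPolynomial (Fin n) K ⧸ alexDual (edgeIdeal K Gᶜ)) : ℕ) : WithBot (WithTop ℕ)) ∧
    HasLinearResolution (edgeIdeal K Gᶜ) 2 := by
  have hA : ∀ i, i ∈ Finset.univ.filter (fun i : Fin n => i ≠ v ∧ ¬ G.Adj v i) ↔
      i ≠ v ∧ ¬ G.Adj v i := fun i => by simp
  set A := Finset.univ.filter (fun i : Fin n => i ≠ v ∧ ¬ G.Adj v i) with hAdef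
  have hvA : v ∉ A := fun h => ((hA v).mp h).1 rfl
  have hne : ∃ o, o ∈ A := by
    obtain ⟨i, j, hij, hG⟩ := hnc
    by_cases hi : i = v
    · subst hi
      exact ⟨j, (hA j).mpr ⟨hij.symm, hG⟩⟩
    · by_cases hj : j = v
      · subst hj
        exact ⟨i, (hA i).mpr ⟨hij, fun h => hG h.symm⟩⟩
      · exact absurd (hcomp i j hi hj hij) hG
  obtain ⟨o, hoA⟩ := hne
  have hE := edgeIdeal_compl_eq (K := K) n G v hcomp A hA
  have hD := alexDual_eq (K := K) v A hvA
  rw [hE, hD]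
  exact ⟨rfl, dim_eq_depth n v o A hvA hoA, hasLinearResolution_aux v A⟩
end
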